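/- arXiv:2501.06630 — 2 statements merged into one kernel-verified Lean document; each statement's English description precedes it below -/
import Mathlib

section
/- Let μ be a discrete growth rate with μ_{n+1}/μ_n ≤ θ for all n and some θ ≥ 1. Assume: (1) the system x_{n+1}=A_n x_n, with {A_n}_{n≥1} invertible bounded operators on a Banach space X, admits a μ-dichotomy with respect to a sequence of norms {‖·‖_m} each equivalent to ‖·‖; (2) there exist K, a > 0 with ‖Φ_A(m,k)x‖_m ≤ K(μ_m/μ_k)^a‖x‖_k for m ≥ k and ‖Φ_A(m,k)x‖_m ≤ K(μ_k/μ_m)^a‖x‖_k for m ≤ k; (3) there exists M > 0 with ‖g_n(x)‖_{n+1} ≤ M μ'_n/μ_n for all n, x; (4) there exists c > 0 with ‖g_n(x)−g_n(y)‖_{n+1} ≤ c(μ'_n/μ_n)‖x−y‖_n for all n, x, y. Then, provided c is sufficiently small, there exists a sequence (h_n)_{n≥1} of homeomorphisms h_n : X → X such that: (a) h_{n+1}∘(A_n+g_n) = A_n∘h_n for all n; (b) there exists D > 0 with ‖h_n(x)−x‖_n ≤ D and ‖h_n^{−1}(x)−x‖_n ≤ D for all n, x; (c) there exist K̄, ϱ,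 δ > 0 with ‖h_n(x)−h_n(y)‖_n ≤ K̄‖x−y‖_n^ϱ and ‖h_n^{−1}(x)−h_n^{−1}(y)‖_n ≤ K̄‖x−y‖_n^ϱ whenever ‖x−y‖_n ≤ δ. -/
noncomputable section

open Filter Metric Set Topology

variable {X : Type*} [NormedAddCommGroup X] [NormedSpace ℝ X]

/-- A discrete growth rate: strictly increasing, `μ 0 = 1`, `μ n → ∞`. -/
def IsGrowthRate (μ : ℕ → ℝ) : Prop :=
  StrictMono μ ∧ μ 0 = 1 ∧ Filter.Tendsto μ Filter.atTop Filter.atTop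

/-- The piecewise linear extension `μ̃` of a growth rate. -/
def tildeExt (μ : ℕ → ℝ) (t : ℝ) : ℝ :=
  μ ⌊t⌋₊ + (t - (⌊t⌋₊ : ℝ)) * (μ (⌊t⌋₊ + 1) - μ ⌊t⌋₊)

/-- `⌊μ̃⁻¹ t⌋`, i.e. the largest `n` with `μ n ≤ t` (for `t ≥ 1`). -/
def floorInvTilde (μ : ℕ → ℝ) (t : ℝ) : ℕ := sSup {n : ℕ | μ n ≤ t}

/-- `⌊μ̃⁻¹ (η (k-1))⌋ + 1`. -/
def idxQ (μ η : ℕ → ℝ) (k : ℕ) : ℕ := floorInvTilde μ (η (k - 1)) + 1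

def evolFwd (A : ℕ → X →L[ℝ] X) (k : ℕ) : ℕ → X →L[ℝ] X
  | 0 => ContinuousLinearMap.id ℝ X
  | n + 1 => (A (k + n)).comp (evolFwd A k n)

/-- The evolution family `Φ_A(m,k) = A_{m-1} ∘ ⋯ ∘ A_k` for `m ≥ k`. -/
def evol (A : ℕ → X →L[ℝ] X) (m k : ℕ) : X →L[ℝ] X := evolFwd A k (m - k)

def evolFwdE (A : ℕ → X ≃L[ℝ] X) (k : ℕ) : ℕ → X ≃L[ℝ] X
  | 0 => ContinuousLinearEquiv.refl ℝ X
  | n + 1 => (evolFwdE A k n).trans (A (k + n))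

/-- Two-sided evolution family of a sequence of invertible operators:
`Φ_A(m,k) = A_{m-1}⋯A_k` for `m > k`, `Id` for `m = k`, `A_m⁻¹⋯A_{k-1}⁻¹` for `m < k`. -/
def evolEquiv (A : ℕ → X ≃L[ℝ] X) (m k : ℕ) : X ≃L[ℝ] X :=
  if k ≤ m then evolFwdE A k (m - k) else (evolFwdE A m (k - m)).symm

def evolE (A : ℕ → X ≃L[ℝ] X) (m k : ℕ) : X →L[ℝ] X := (evolEquiv A m k : X →L[ℝ] X)

/-- The time-rescaled sequence `Q_n^{μ,η} = Φ_A(⌊μ̃⁻¹(η n)⌋+1, ⌊μ̃⁻¹(η (n-1))⌋+1)`. -/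
def Qseq (A : ℕ → X →L[ℝ] X) (μ η : ℕ → ℝ) (n : ℕ) : X →L[ℝ] X :=
  evol A (idxQ μ η (n + 1)) (idxQ μ η n)

def QseqE (A : ℕ → X ≃L[ℝ] X) (μ η : ℕ → ℝ) (n : ℕ) : X ≃L[ℝ] X :=
  evolEquiv A (idxQ μ η (n + 1)) (idxQ μ η n)

/-- A sequence of norms on `X`. -/
def IsNormFamily (Nrm : ℕ → X → ℝ) : Prop :=
  ∀ k, (∀ x y : X, Nrm k (x + y) ≤ Nrm k x + Nrm k y) ∧
    (∀ (c : ℝ) (x : X), Nrm k (c • x) = |c| * Nrm k x) ∧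
    (∀ x : X, Nrm k x = 0 → x = 0)

/-- Each norm in the family is equivalent to the ambient norm. -/
def NormsEquivalent (Nrm : ℕ → X → ℝ) : Prop :=
  ∀ k, ∃ α β : ℝ, 0 < α ∧ 0 < β ∧ ∀ x : X, α * ‖x‖ ≤ Nrm k x ∧ Nrm k x ≤ β * ‖x‖

/-- (od1)–(od2): a sequence of projections compatible with the dynamics, such that the
restriction of `A k` to `Ker P k` is an isomorphism onto `Ker P (k+1)`. -/
def ProjectionsCompat (A P : ℕ → X →L[ℝ] X) : Prop :=
  (∀ k, 1 ≤ k → (P k).comp (P k) = P k) ∧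
  (∀ k, 1 ≤ k → (A k).comp (P k) = (P (k + 1)).comp (A k)) ∧
  (∀ k, 1 ≤ k → Set.BijOn (⇑(A k)) {x : X | P k x = 0} {x : X | P (k + 1) x = 0})

/-- μ-dichotomy with respect to a sequence of norms, relative to given projections.
For `m ≤ k`, `Φ_A(m,k)(Id - P_k)x` denotes the unique `z ∈ Ker P_m` with
`Φ_A(k,m) z = (Id - P_k) x`. -/
def MuDichotomyNormsWith (μ : ℕ → ℝ) (A P : ℕ → X →L[ℝ] X) (Nrm : ℕ → X → ℝ) : Prop :=
  ProjectionsCompat A P ∧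
  ∃ N ν : ℝ, 1 ≤ N ∧ 0 < ν ∧
    (∀ k m : ℕ, 1 ≤ k → k ≤ m → ∀ x : X,
      Nrm m (evol A m k (P k x)) ≤ N * (μ m / μ k) ^ (-ν) * Nrm k x) ∧
    (∀ m k : ℕ, 1 ≤ m → m ≤ k → ∀ x z : X, P m z = 0 → evol A k m z = x - P k x →
      Nrm m z ≤ N * (μ k / μ m) ^ (-ν) * Nrm k x)

/-- Ordinary dichotomy with respect to a sequence of norms, relative to given projections. -/
def OrdinaryDichotomyNormsWith (A P : ℕ → X →L[ℝ] X) (Nrm : ℕ → X → ℝ) : Prop :=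
  ProjectionsCompat A P ∧
  ∃ K : ℝ, 1 ≤ K ∧
    (∀ k m : ℕ, 1 ≤ k → k ≤ m → ∀ x : X, Nrm m (evol A m k (P k x)) ≤ K * Nrm k x) ∧
    (∀ m k : ℕ, 1 ≤ m → m ≤ k → ∀ x z : X, P m z = 0 → evol A k m z = x - P k x →
      Nrm m z ≤ K * Nrm k x)

/-- μ-dichotomy (with respect to a sequence of norms) of a system of invertible operators. -/
def MuDichotomyNormsE (μ : ℕ → ℝ) (A : ℕ → X ≃L[ℝ] X) (Nrm : ℕ → X → ℝ) : Prop :=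
  ∃ P : ℕ → X →L[ℝ] X,
    (∀ k, 1 ≤ k → (P k).comp (P k) = P k) ∧
    (∀ k, 1 ≤ k → ((A k : X →L[ℝ] X)).comp (P k) = (P (k + 1)).comp ((A k : X →L[ℝ] X))) ∧
    (∀ k, 1 ≤ k → Set.BijOn (⇑(A k)) {x : X | P k x = 0} {x : X | P (k + 1) x = 0}) ∧
    ∃ N ν : ℝ, 1 ≤ N ∧ 0 < ν ∧
      (∀ k m : ℕ, 1 ≤ k → k ≤ m → ∀ x : X,
        Nrm m (evolE A m k (P k x)) ≤ N * (μ m / μ k) ^ (-ν) * Nrm k x) ∧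
      (∀ m k : ℕ, 1 ≤ m → m ≤ k → ∀ x : X,
        Nrm m (evolE A m k (x - P k x)) ≤ N * (μ k / μ m) ^ (-ν) * Nrm k x)

/-- μ-dichotomy with respect to the original norm. -/
def MuDichotomy (μ : ℕ → ℝ) (B : ℕ → X →L[ℝ] X) : Prop :=
  ∃ P : ℕ → X →L[ℝ] X, MuDichotomyNormsWith μ B P fun _ x => ‖x‖

/-- The scaled system `Ã_n = (μ_{n+1}/μ_n)^{-λ} A_n`. -/
def scaledSys (μ : ℕ → ℝ) (A : ℕ → X ≃L[ℝ] X) (l : ℝ) (n : ℕ) : X →L[ℝ] X :=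
  ((μ (n + 1) / μ n) ^ (-l)) • (A n : X →L[ℝ] X)

/-- The generalized dichotomy spectrum `Σ_{μD,𝔸}`. -/
def muSpectrum (μ : ℕ → ℝ) (A : ℕ → X ≃L[ℝ] X) : Set ℝ :=
  {l : ℝ | ¬ MuDichotomy μ (scaledSys μ A l)}

/-- The exponential growth rate `n ↦ e^n`. -/
def expRate : ℕ → ℝ := fun n => Real.exp n

/-- `Σ_{ED,ℚ}`: the Sacker–Sell spectrum of the time-rescaled system. -/
def expSpectrumQ (μ : ℕ → ℝ) (A : ℕ → X ≃L[ℝ] X) : Set ℝ :=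
  {l : ℝ | ¬ MuDichotomy expRate fun n => Real.exp (-l) • (QseqE A μ expRate n : X →L[ℝ] X)}

/-- `f` is a homeomorphism. -/
def IsHomeoOf {Y : Type*} [TopologicalSpace Y] (f : Y → Y) : Prop :=
  ∃ h : Y ≃ₜ Y, ∀ x, h x = f x

/-- The perturbed maps `x ↦ A_n x + g_n x`. -/
def pert (A : ℕ → X ≃L[ℝ] X) (g : ℕ → X → X) (n : ℕ) : X → X := fun x => A n x + g n x

def nlFwd (F : ℕ → X → X) (n : ℕ) : ℕ → X → X
  | 0 => id
  | j + 1 => F (n + j) ∘ nlFwd F n j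

/-- Nonlinear evolution `𝒢(m,n) = (A_{m-1}+g_{m-1})∘⋯∘(A_n+g_n)` for `m ≥ n`. -/
def nlEvol (A : ℕ → X ≃L[ℝ] X) (g : ℕ → X → X) (m n : ℕ) : X → X := nlFwd (pert A g) n (m - n)

def nlBwd (F : ℕ → X → X) (m : ℕ) : ℕ → X → X
  | 0 => id
  | j + 1 => nlBwd F m j ∘ Function.invFun (F (m + j))

/-- Nonlinear evolution `𝒢(m,n) = (A_m+g_m)⁻¹∘⋯∘(A_{n-1}+g_{n-1})⁻¹` for `m ≤ n`. -/
def nlEvolBwd (A : ℕ → X ≃L[ℝ] X) (g : ℕ → X → X) (m n : ℕ) : X → X :=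
  nlBwd (pert A g) m (n - m)

/-- The rescaled nonlinearities `f_n`. -/
def fSeq (A : ℕ → X ≃L[ℝ] X) (g : ℕ → X → X) (μ : ℕ → ℝ) (n : ℕ) (x : X) : X :=
  ∑ j ∈ Finset.Icc (floorInvTilde μ (expRate (n - 1)) + 1) (floorInvTilde μ (expRate n)),
    evolE A (floorInvTilde μ (expRate n) + 1) (j + 1)
      (g j (nlEvol A g j (floorInvTilde μ (expRate (n - 1)) + 1) x))

/-- The class `𝒪_μ^k`, with constant `M`. -/
def InOmegaMu (μ : ℕ → ℝ) (k : ℕ) (f : ℕ → X → X) (M : ℝ) : Prop :=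
  (∀ n, ContDiff ℝ (k : ℕ∞) (f n)) ∧ (∀ n, f n 0 = 0) ∧ (∀ n, fderiv ℝ (f n) 0 = 0) ∧
  ∀ n, 1 ≤ n → ∀ x : X, ∀ j : ℕ, j ≤ k →
    ‖iteratedFDeriv ℝ j (f n) x‖ ≤ M * (μ (n + 1) - μ n) / μ n

/-- The symmetric ratio of the values of a positive sequence at two times. -/
def symRatio (μ : ℕ → ℝ) (m k : ℕ) : ℝ := max (μ m / μ k) (μ k / μ m)

section SymRatio

variable {μ : ℕ → ℝ}

lemma one_le_symRatio (hpos : ∀ n, 0 < μ n) (m k : ℕ) : 1 ≤ symRatio μ m k := by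
  rcases le_total (μ m) (μ k) with h | h
  · exact le_max_of_le_right ((one_le_div (hpos m)).2 h)
  · exact le_max_of_le_left ((one_le_div (hpos k)).2 h)

lemma symRatio_self (hpos : ∀ n, 0 < μ n) (m : ℕ) : symRatio μ m m = 1 := by
  simp [symRatio, (hpos m).ne']

lemma symRatio_comm (m k : ℕ) : symRatio μ m k = symRatio μ k m := max_comm _ _

lemma symRatio_of_le (hpos : ∀ n, 0 < μ n) (hmono : Monotone μ) {m k : ℕ} (h : k ≤ m) :
    symRatio μ m k = μ m / μ k := by
  refine max_eq_left ?_
  exact ((div_le_one (hpos m)).2 (hmono h)).trans ((one_le_div (hpos k)).2 (hmono h))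

lemma symRatio_le_mul (hpos : ∀ n, 0 < μ n) (m k l : ℕ) :
    symRatio μ m l ≤ symRatio μ m k * symRatio μ k l := by
  have hm := hpos m
  have hk := hpos k
  have hl := hpos l
  refine max_le ?_ ?_
  · calc μ m / μ l = (μ m / μ k) * (μ k / μ l) := by field_simp
      _ ≤ _ := mul_le_mul (le_max_left _ _) (le_max_left _ _) (by positivity)
        (zero_le_one.trans (one_le_symRatio hpos m k))
  · calc μ l / μ m = (μ k / μ m) * (μ l / μ k) := by field_simp
      _ ≤ _ := mul_le_mul (le_max_right _ _) (le_max_right _ _) (by positivity)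
        (zero_le_one.trans (one_le_symRatio hpos m k))

lemma symRatio_succ_le (hpos : ∀ n, 0 < μ n) (hmono : Monotone μ) {θ : ℝ}
    (hθ : ∀ n, μ (n + 1) / μ n ≤ θ) (n : ℕ) : symRatio μ n (n + 1) ≤ θ := by
  rw [symRatio_comm, symRatio_of_le hpos hmono n.le_succ]
  exact hθ n

lemma symRatio_mul_le_of_between (hpos : ∀ n, 0 < μ n) (hmono : Monotone μ) {θ : ℝ}
    (hθ : ∀ n, μ (n + 1) / μ n ≤ θ) {n j m : ℕ} (h : n ≤ j ∧ j < m ∨ m ≤ j ∧ j < n) :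
    symRatio μ j n * symRatio μ m (j + 1) ≤ θ * symRatio μ m n := by
  have hm := hpos m
  have hn := hpos n
  have hj := hpos j
  have hj' := hpos (j + 1)
  rcases h with ⟨h1, h2⟩ | ⟨h1, h2⟩
  · rw [symRatio_of_le hpos hmono h1, symRatio_of_le hpos hmono (Nat.succ_le_of_lt h2),
      symRatio_of_le hpos hmono (h1.trans h2.le)]
    have h3 : μ j / μ (j + 1) ≤ 1 := (div_le_one hj').2 (hmono j.le_succ)
    have h4 : 1 ≤ μ (j + 1) / μ j := (one_le_div hj).2 (hmono j.le_succ)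
    calc μ j / μ n * (μ m / μ (j + 1)) = (μ j / μ (j + 1)) * (μ m / μ n) := by field_simp
      _ ≤ θ * (μ m / μ n) := by
        gcongr
        exact h3.trans (h4.trans (hθ j))
  · rw [symRatio_comm j n, symRatio_comm m (j + 1), symRatio_comm m n,
      symRatio_of_le hpos hmono h2.le, symRatio_of_le hpos hmono (h1.trans j.le_succ),
      symRatio_of_le hpos hmono (h1.trans h2.le)]
    calc μ n / μ j * (μ (j + 1) / μ m) = (μ (j + 1) / μ j) * (μ n / μ m) := by field_simp
      _ ≤ θ * (μ n / μ m) := by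
        gcongr
        exact hθ j

lemma sub_one_le_mul_one_sub_rpow_neg {θ κ r : ℝ} (hκ : 0 < κ) (hr : 1 ≤ r) (hrθ : r ≤ θ) :
    r - 1 ≤ θ ^ (κ + 1) / κ * (1 - r ^ (-κ)) := by
  have hr0 : 0 < r := by linarith
  have hθ0 : 0 < θ := by linarith
  have hlog : 1 - r⁻¹ ≤ Real.log r := Real.one_sub_inv_le_log_of_pos hr0
  have hpow : κ * Real.log r + 1 ≤ r ^ κ := by
    rw [Real.rpow_def_of_pos hr0, mul_comm]
    exact Real.add_one_le_exp _
  have hrk : 0 < r ^ κ := Real.rpow_pos_of_pos hr0 κ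
  have h1 : κ * (r - 1) ≤ r * (r ^ κ - 1) := by
    have : r * (1 - r⁻¹) = r - 1 := by field_simp
    nlinarith [mul_le_mul_of_nonneg_left hlog hr0.le]
  have h2 : r * (r ^ κ - 1) = r ^ (κ + 1) * (1 - r ^ (-κ)) := by
    rw [Real.rpow_add_one hr0.ne', Real.rpow_neg hr0.le]
    field_simp
  have h3 : r ^ (κ + 1) ≤ θ ^ (κ + 1) := Real.rpow_le_rpow hr0.le hrθ (by linarith)
  have h4 : 0 ≤ 1 - r ^ (-κ) := by
    have := Real.rpow_le_one_of_one_le_of_nonpos hr (neg_nonpos.2 hκ.le)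
    linarith
  rw [div_mul_eq_mul_div, le_div_iff₀ hκ]
  nlinarith [mul_le_mul_of_nonneg_right h3 h4]

lemma exists_symRatio_sum_bound (hpos : ∀ n, 0 < μ n) (hmono : Monotone μ) {θ : ℝ}
    (hθ : ∀ n, μ (n + 1) / μ n ≤ θ) {κ : ℝ} (hκ : 0 < κ) :
    ∃ S : ℝ, 0 < S ∧ ∀ m,
      Summable (fun j => symRatio μ m (j + 1) ^ (-κ) * ((μ (j + 1) - μ j) / μ j)) ∧
      ∑' j, symRatio μ m (j + 1) ^ (-κ) * ((μ (j + 1) - μ j) / μ j) ≤ S := by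
  have hone : ∀ j, 1 ≤ μ (j + 1) / μ j := fun j => (one_le_div (hpos j)).2 (hmono j.le_succ)
  have hθ0 : 0 < θ := zero_lt_one.trans_le ((hone 0).trans (hθ 0))
  set C := θ ^ (κ + 1) / κ with hC
  have hC0 : 0 < C := by positivity
  refine ⟨C * 2, by positivity, fun m => ?_⟩
  set w : ℕ → ℝ := fun j => symRatio μ m (j + 1) ^ (-κ) * ((μ (j + 1) - μ j) / μ j) with hw
  have hw0 : ∀ j, 0 ≤ w j := fun j =>
    mul_nonneg (Real.rpow_nonneg (zero_le_one.trans (one_le_symRatio hpos _ _)) _)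
      (div_nonneg (sub_nonneg.2 (hmono j.le_succ)) (hpos j).le)
  let φ : ℕ → ℝ := fun j => if j ≤ m then (μ j / μ m) ^ κ else 2 - (μ m / μ j) ^ κ
  have hm := hpos m
  have hφ0 : 0 ≤ φ 0 := by
    have := hpos 0
    simp only [φ, Nat.zero_le, if_true]
    positivity
  have hφ2 : ∀ j, φ j ≤ 2 := fun j => by
    have hj := hpos j
    simp only [φ]
    split_ifs with h
    · have : (μ j / μ m) ^ κ ≤ 1 :=
        Real.rpow_le_one (by positivity) ((div_le_one hm).2 (hmono h)) hκ.le
      linarith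
    · have : 0 ≤ (μ m / μ j) ^ κ := by positivity
      linarith
  have hd : ∀ j, (μ (j + 1) - μ j) / μ j ≤ C * (1 - (μ j / μ (j + 1)) ^ κ) := fun j => by
    have hj := hpos j
    have hj' := hpos (j + 1)
    have := sub_one_le_mul_one_sub_rpow_neg hκ (hone j) (hθ j)
    rw [Real.rpow_neg (by positivity), ← Real.inv_rpow (by positivity), inv_div] at this
    rwa [sub_div, div_self hj.ne']
  have hle : ∀ j, w j ≤ C * (φ (j + 1) - φ j) := fun j => by
    have hj := hpos j
    have hj' := hpos (j + 1)
    rcases lt_or_ge j m with h | h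
    · have h1 : φ (j + 1) - φ j
          = (μ (j + 1) / μ m) ^ κ * (1 - (μ j / μ (j + 1)) ^ κ) := by
        simp only [φ, if_pos h.le, if_pos (Nat.succ_le_of_lt h)]
        rw [mul_sub, ← Real.mul_rpow (by positivity) (by positivity), mul_one]
        congr 3
        field_simp
      have h2 : symRatio μ m (j + 1) ^ (-κ) = (μ (j + 1) / μ m) ^ κ := by
        rw [symRatio_of_le hpos hmono (Nat.succ_le_of_lt h), Real.rpow_neg (by positivity),
          ← Real.inv_rpow (by positivity), inv_div]
      simp only [hw]
      rw [h1, h2, mul_left_comm]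
      exact mul_le_mul_of_nonneg_left (hd j) (by positivity)
    · have h0 : φ j = 2 - (μ m / μ j) ^ κ := by
        simp only [φ]
        split_ifs with h'
        · obtain rfl : j = m := le_antisymm h' h
          rw [div_self hj.ne', Real.one_rpow]
          norm_num
        · rfl
      have h1 : φ (j + 1) - φ j = (μ m / μ j) ^ κ * (1 - (μ j / μ (j + 1)) ^ κ) := by
        rw [h0]
        simp only [φ, if_neg (not_le.2 (Nat.lt_succ_of_le h))]
        rw [mul_sub, ← Real.mul_rpow (by positivity) (by positivity), mul_one]
        have : μ m / μ j * (μ j / μ (j + 1)) = μ m / μ (j + 1) := by field_simp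
        rw [this]
        ring
      have h2 : symRatio μ m (j + 1) ^ (-κ) = (μ m / μ (j + 1)) ^ κ := by
        rw [symRatio_comm, symRatio_of_le hpos hmono (h.trans j.le_succ),
          Real.rpow_neg (by positivity), ← Real.inv_rpow (by positivity), inv_div]
      have h3 : (μ m / μ (j + 1)) ^ κ ≤ (μ m / μ j) ^ κ := by
        have := hmono j.le_succ
        gcongr
      simp only [hw]
      rw [h1, h2, mul_left_comm]
      exact mul_le_mul h3 (hd j) (div_nonneg (sub_nonneg.2 (hmono j.le_succ)) hj.le)
        (by positivity)
  have hsum : ∀ J, ∑ j ∈ Finset.range J, w j ≤ C * 2 := fun J =>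
    calc ∑ j ∈ Finset.range J, w j ≤ ∑ j ∈ Finset.range J, C * (φ (j + 1) - φ j) :=
          Finset.sum_le_sum fun j _ => hle j
      _ = C * (φ J - φ 0) := by rw [← Finset.mul_sum, Finset.sum_range_sub]
      _ ≤ C * 2 := mul_le_mul_of_nonneg_left (by linarith [hφ2 J]) hC0.le
  exact ⟨summable_of_sum_range_le hw0 hsum, Real.tsum_le_of_sum_range_le hw0 hsum⟩

end SymRatio

section FixedPoint

lemma le_of_forall_bootstrap {ι : Type*} {s : Set ι} {e w : ι → ℝ} {C L₀ : ℝ}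
    (hw : ∀ i ∈ s, 0 ≤ w i) (hC : 0 ≤ C) (hL₀ : 0 ≤ L₀) (h₀ : ∀ i ∈ s, e i ≤ L₀ * w i)
    (hstep : ∀ L, 0 ≤ L → (∀ i ∈ s, e i ≤ L * w i) → ∀ i ∈ s, e i ≤ (C + L / 2) * w i) :
    ∀ i ∈ s, e i ≤ 2 * C * w i := by
  have key : ∀ k : ℕ, ∀ i ∈ s, e i ≤ (2 * C + L₀ * (1 / 2) ^ k) * w i := by
    intro k
    induction k with
    | zero =>
      intro i hi
      refine (h₀ i hi).trans (mul_le_mul_of_nonneg_right ?_ (hw i hi))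
      simp [hC]
    | succ k ih =>
      intro i hi
      refine (hstep _ (by positivity) ih i hi).trans_eq ?_
      ring
  intro i hi
  have hlim : Tendsto (fun k : ℕ => (2 * C + L₀ * (1 / 2) ^ k) * w i) atTop
      (𝓝 ((2 * C + L₀ * 0) * w i)) :=
    ((tendsto_const_nhds.add ((tendsto_pow_atTop_nhds_zero_of_lt_one (by norm_num)
      (by norm_num)).const_mul L₀)).mul_const (w i))
  simpa using ge_of_tendsto' hlim fun k => key k i hi

lemma Seminorm.continuous_of_le_mul_norm {q : Seminorm ℝ X} {β : ℝ}
    (hq : ∀ x, q x ≤ β * ‖x‖) : Continuous q := by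
  refine Seminorm.continuous_of_continuousAt_zero ?_
  rw [ContinuousAt, map_zero]
  refine squeeze_zero (fun x => apply_nonneg q x) hq ?_
  simpa using (continuous_const.mul (continuous_norm (E := X))).tendsto 0 (f := fun x => β * ‖x‖)

lemma Seminorm.tsum_le_tsum {q : Seminorm ℝ X} (hq : Continuous q) {f : ℕ → X} {b : ℕ → ℝ}
    (hf : Summable f) (hb : Summable b) (h : ∀ j, q (f j) ≤ b j) :
    q (∑' j, f j) ≤ ∑' j, b j := by
  refine le_of_tendsto' ((hq.tendsto _).comp hf.hasSum) fun s => ?_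
  calc q (∑ j ∈ s, f j) ≤ ∑ j ∈ s, q (f j) :=
        Finset.le_sum_of_subadditive q (map_zero q).le (map_add_le_add q) s f
    _ ≤ ∑ j ∈ s, b j := Finset.sum_le_sum fun j _ => h j
    _ ≤ ∑' j, b j := hb.sum_le_tsum _ fun j _ => (apply_nonneg q _).trans (h j)

/-- Banach's fixed point theorem for families of vectors, the distance being the supremum of
the distances of the components with respect to norms equivalent to the ambient one. -/
lemma exists_fixed_family [CompleteSpace X] {ι : Type*} (p : ι → Seminorm ℝ X)
    (hp : ∀ i, ∃ α β : ℝ, 0 < α ∧ 0 < β ∧ ∀ x : X, α * ‖x‖ ≤ p i x ∧ p i x ≤ β * ‖x‖)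
    (T : (ι → X) → ι → X) (B : ℝ) (hB : ∀ i, p i (T 0 i) ≤ B)
    (hT : ∀ v w D, (∀ i, p i (v i - w i) ≤ D) → ∀ i, p i (T v i - T w i) ≤ D / 2) :
    ∃ v, T v = v := by
  have hcont : ∀ i, Continuous (p i) := fun i => by
    obtain ⟨α, β, -, -, h⟩ := hp i
    exact Seminorm.continuous_of_le_mul_norm fun x => (h x).2
  let u : ℕ → ι → X := fun k => T^[k] 0
  have hu : ∀ k, u (k + 1) = T (u k) := fun k => Function.iterate_succ_apply' T k 0
  have hstep : ∀ k i, p i (u (k + 1) i - u k i) ≤ B / 2 ^ k := by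
    intro k
    induction k with
    | zero => intro i; simpa [u] using hB i
    | succ k ih =>
      intro i
      rw [hu (k + 1)]
      have h1 := hT (u (k + 1)) (u k) _ ih i
      rwa [hu k, div_div, ← pow_succ, ← hu k] at h1
  have htail : ∀ k l i, p i (u (k + l) i - u k i) ≤ 2 * B / 2 ^ k - B / 2 ^ (k + l) * 2 := by
    intro k l i
    induction l with
    | zero => simp; ring_nf; rfl
    | succ l ih =>
      have h1 := map_add_le_add (p i) (u (k + l + 1) i - u (k + l) i) (u (k + l) i - u k i)
      rw [sub_add_sub_cancel] at h1
      have h2 := hstep (k + l) i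
      have h3 : B / 2 ^ (k + (l + 1)) * 2 = B / 2 ^ (k + l) := by
        rw [← add_assoc, pow_succ]; field_simp
      rw [h3, ← add_assoc]
      linarith
  have hlim : ∀ i, ∃ x, Tendsto (fun k => u k i) atTop (𝓝 x) := fun i => by
    obtain ⟨α, β, hα, -, h⟩ := hp i
    refine cauchySeq_tendsto_of_complete (cauchySeq_of_le_geometric_two (C := 2 * (B / α)) ?_)
    intro k
    rw [dist_comm, dist_eq_norm]
    have h1 : α * ‖u (k + 1) i - u k i‖ ≤ B / 2 ^ k := ((h _).1).trans (hstep k i)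
    rw [← le_div_iff₀' hα] at h1
    refine h1.trans_eq ?_
    field_simp
  choose v hv using hlim
  have hB0 : ∀ i : ι, 0 ≤ B := fun i => (apply_nonneg (p i) _).trans (hB i)
  have hvu : ∀ k i, p i (v i - u k i) ≤ 2 * B / 2 ^ k := fun k i => by
    have hl : Tendsto (fun l => p i (u (k + l) i - u k i)) atTop (𝓝 (p i (v i - u k i))) := by
      refine ((hcont i).tendsto _).comp (Tendsto.sub_const ?_ _)
      exact (hv i).comp (tendsto_atTop_mono (fun l => Nat.le_add_left l k) tendsto_id)
    refine le_of_tendsto' hl fun l => (htail k l i).trans ?_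
    have := hB0 i
    have : 0 ≤ B / 2 ^ (k + l) * 2 := by positivity
    linarith
  refine ⟨v, funext fun i => ?_⟩
  obtain ⟨α, β, hα, -, h⟩ := hp i
  have hbd : ∀ k : ℕ, p i (T v i - v i) ≤ 4 * B * (1 / 2) ^ k := fun k => by
    have h1 := hT v (u k) _ (hvu k) i
    have h2 := hvu (k + 1) i
    have h3 := map_sub_le_add (p i) (T v i - T (u k) i) (v i - T (u k) i)
    rw [sub_sub_sub_cancel_right] at h3
    rw [hu] at h2
    have h4 : 2 * B / 2 ^ k / 2 + 2 * B / 2 ^ (k + 1) ≤ 4 * B * (1 / 2) ^ k := by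
      rw [pow_succ, one_div, inv_pow]
      have := hB0 i
      have h5 : 0 ≤ B * (2 ^ k)⁻¹ := by positivity
      calc _ = 2 * (B * (2 ^ k)⁻¹) := by field_simp; ring
        _ ≤ _ := by linarith
    linarith
  have hz : p i (T v i - v i) ≤ 0 := by
    have hlim : Tendsto (fun k : ℕ => 4 * B * (1 / 2 : ℝ) ^ k) atTop (𝓝 (4 * B * 0)) :=
      (tendsto_pow_atTop_nhds_zero_of_lt_one (by norm_num) (by norm_num)).const_mul _
    simpa using ge_of_tendsto' hlim hbd
  have h1 := ((h (T v i - v i)).1).trans hz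
  have h2 : ‖T v i - v i‖ ≤ 0 := nonpos_of_mul_nonpos_right h1 hα
  exact sub_eq_zero.1 (norm_le_zero_iff.1 h2)

/-- A map which is locally uniformly Hölder with respect to an equivalent norm is continuous. -/
lemma continuous_of_holder {q : Seminorm ℝ X} {α β C ρ : ℝ} (hα : 0 < α)
    (hq : ∀ x : X, α * ‖x‖ ≤ q x ∧ q x ≤ β * ‖x‖) (hρ : 0 < ρ) {f : X → X}
    (hf : ∀ x y, q (x - y) ≤ 1 → q (f x - f y) ≤ C * q (x - y) ^ ρ) : Continuous f := by
  have hqc := Seminorm.continuous_of_le_mul_norm fun x => (hq x).2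
  refine continuous_iff_continuousAt.2 fun x => ?_
  have h1 : Tendsto (fun y => q (y - x)) (𝓝 x) (𝓝 0) := by
    have : Continuous fun y => q (y - x) := hqc.comp (continuous_id.sub continuous_const)
    simpa using this.tendsto x
  have h2 : Tendsto (fun y => C * q (y - x) ^ ρ / α) (𝓝 x) (𝓝 0) := by
    have := ((h1.rpow_const (Or.inr hρ.le) (p := ρ)).const_mul C).div_const α
    simpa [Real.zero_rpow hρ.ne'] using this
  rw [ContinuousAt, tendsto_iff_norm_sub_tendsto_zero]
  refine squeeze_zero' (Eventually.of_forall fun _ => norm_nonneg _) ?_ h2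
  filter_upwards [h1.eventually (ge_mem_nhds zero_lt_one)] with y hy
  rw [le_div_iff₀' hα]
  exact ((hq _).1).trans (hf y x hy)

end FixedPoint

section Green

lemma eq_of_recurrence {Y : Type*} {F : ℕ → Y → Y} (hF : ∀ n, Function.Injective (F n)) {y y' : ℕ → Y}
    (hy : ∀ m, y (m + 1) = F m (y m)) (hy' : ∀ m, y' (m + 1) = F m (y' m)) {n : ℕ}
    (h : y n = y' n) : y = y' := by
  have h0 : ∀ k, y k = y' k → y 0 = y' 0 := by
    intro k
    induction k with
    | zero => exact id
    | succ k ih => exact fun hk => ih (hF k (by rw [← hy, ← hy', hk]))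
  funext m
  induction m with
  | zero => exact h0 n h
  | succ m ih => rw [hy, hy', ih]

/-- A linear nonautonomous system together with its evolution family, a Green function solving
the inhomogeneous problem, and the growth and dichotomy bounds relative to a growth rate `μ`
and a sequence of norms `p`. -/
structure GreenData (E : Type*) [NormedAddCommGroup E] [NormedSpace ℝ E] where
  A : ℕ → E ≃L[ℝ] E
  p : ℕ → Seminorm ℝ E
  Φ : ℕ → ℕ → E →L[ℝ] E
  G : ℕ → ℕ → E →L[ℝ] E
  μ : ℕ → ℝ
  θ : ℝ
  K : ℝ
  a : ℝ
  N : ℝ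
  ν : ℝ
  equiv_norm : ∀ i, ∃ α β : ℝ, 0 < α ∧ 0 < β ∧ ∀ x : E, α * ‖x‖ ≤ p i x ∧ p i x ≤ β * ‖x‖
  pos : ∀ n, 0 < μ n
  mono : Monotone μ
  ratio_le : ∀ n, μ (n + 1) / μ n ≤ θ
  K_pos : 0 < K
  a_pos : 0 < a
  N_pos : 0 < N
  ν_pos : 0 < ν
  Φ_self : ∀ n x, Φ n n x = x
  Φ_succ : ∀ m k x, Φ (m + 1) k x = A m (Φ m k x)
  Φ_le : ∀ m k x, p m (Φ m k x) ≤ K * symRatio μ m k ^ a * p k x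
  G_succ_self : ∀ m z, G (m + 1) m z = A m (G m m z) + z
  G_succ : ∀ m j z, j ≠ m → G (m + 1) j z = A m (G m j z)
  G_le : ∀ m j z, p m (G m j z) ≤ N * symRatio μ m (j + 1) ^ (-ν) * p (j + 1) z

namespace GreenData

variable (D : GreenData X)

/-- The relative increment of the growth rate. -/
def d (j : ℕ) : ℝ := (D.μ (j + 1) - D.μ j) / D.μ j

/-- The symmetric ratio of the growth rate. -/
def R (m k : ℕ) : ℝ := symRatio D.μ m k

/-- The solution of the inhomogeneous equation given by the Green function. -/
def green (f : ℕ → X) (m : ℕ) : X := ∑' j, D.G m j (f j)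

lemma one_le_R (m k : ℕ) : 1 ≤ D.R m k := one_le_symRatio D.pos m k

lemma R_pos (m k : ℕ) : 0 < D.R m k := zero_lt_one.trans_le (D.one_le_R m k)

lemma one_le_θ : 1 ≤ D.θ :=
  ((one_le_div (D.pos 0)).2 (D.mono (Nat.le_succ 0))).trans (D.ratio_le 0)

lemma d_nonneg (j : ℕ) : 0 ≤ D.d j :=
  div_nonneg (sub_nonneg.2 (D.mono j.le_succ)) (D.pos j).le

lemma d_le (j : ℕ) : D.d j ≤ D.θ := by
  have h := D.ratio_le j
  rw [d, sub_div, div_self (D.pos j).ne']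
  linarith

lemma R_le (j m n : ℕ) : D.R j n ≤ D.θ * D.R m (j + 1) * D.R m n := by
  calc D.R j n ≤ D.R j (j + 1) * D.R (j + 1) n := symRatio_le_mul D.pos _ _ _
    _ ≤ D.θ * (D.R (j + 1) m * D.R m n) :=
      mul_le_mul (symRatio_succ_le D.pos D.mono D.ratio_le j) (symRatio_le_mul D.pos _ _ _)
        (D.R_pos _ _).le (zero_le_one.trans D.one_le_θ)
    _ = D.θ * D.R m (j + 1) * D.R m n := by
      rw [R, symRatio_comm (j + 1) m, mul_assoc]
      rfl

lemma eq_of_p_nonpos {n : ℕ} {x y : X} (h : D.p n (x - y) ≤ 0) : x = y := by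
  obtain ⟨α, β, hα, -, hp⟩ := D.equiv_norm n
  have h1 := ((hp (x - y)).1).trans h
  exact sub_eq_zero.1 (norm_le_zero_iff.1 (nonpos_of_mul_nonpos_right h1 hα))

lemma continuous_p (n : ℕ) : Continuous (D.p n) := by
  obtain ⟨α, β, -, -, hp⟩ := D.equiv_norm n
  exact Seminorm.continuous_of_le_mul_norm fun x => (hp x).2

lemma exists_green_bound [CompleteSpace X] :
    ∃ Q : ℝ, 0 < Q ∧ ∀ s C : ℝ, 0 ≤ s → s ≤ D.ν / 2 → 0 ≤ C → ∀ (n : ℕ) (f : ℕ → X),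
      (∀ j, D.p (j + 1) (f j) ≤ C * D.R j n ^ s * D.d j) →
      ∀ m, Summable (fun j => D.G m j (f j)) ∧ D.p m (D.green f m) ≤ Q * C * D.R m n ^ s := by
  obtain ⟨S, hS, hsum⟩ :=
    exists_symRatio_sum_bound D.pos D.mono D.ratio_le (half_pos D.ν_pos)
  have hθ0 : 0 < D.θ := zero_lt_one.trans_le D.one_le_θ
  have hN := D.N_pos
  refine ⟨D.N * D.θ ^ (D.ν / 2) * S, by positivity, fun s C hs hsν hC n f hf m => ?_⟩
  have hRmn : 0 < D.R m n := D.R_pos m n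
  set B : ℝ := D.N * D.θ ^ (D.ν / 2) * C * D.R m n ^ s with hB
  have hB0 : 0 ≤ B := by positivity
  have hterm : ∀ j, D.p m (D.G m j (f j)) ≤
      B * (D.R m (j + 1) ^ (-(D.ν / 2)) * D.d j) := fun j => by
    have hd := D.d_nonneg j
    have hR := D.R_pos m (j + 1)
    have h1 : D.R j n ^ s ≤ D.θ ^ (D.ν / 2) * D.R m (j + 1) ^ (D.ν / 2) * D.R m n ^ s := by
      calc D.R j n ^ s ≤ (D.θ * D.R m (j + 1) * D.R m n) ^ s :=
            Real.rpow_le_rpow (D.R_pos _ _).le (D.R_le j m n) hs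
        _ = D.θ ^ s * D.R m (j + 1) ^ s * D.R m n ^ s := by
            rw [Real.mul_rpow (by positivity) (by positivity),
              Real.mul_rpow (by positivity) (by positivity)]
        _ ≤ _ := by
            gcongr
            · exact D.one_le_θ
            · exact D.one_le_R _ _
    have h2 : D.R m (j + 1) ^ (-D.ν) * D.R m (j + 1) ^ (D.ν / 2)
        = D.R m (j + 1) ^ (-(D.ν / 2)) := by
      rw [← Real.rpow_add hR]
      congr 1
      ring
    calc D.p m (D.G m j (f j)) ≤ D.N * D.R m (j + 1) ^ (-D.ν) * D.p (j + 1) (f j) :=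
          D.G_le m j _
      _ ≤ D.N * D.R m (j + 1) ^ (-D.ν) *
          (C * (D.θ ^ (D.ν / 2) * D.R m (j + 1) ^ (D.ν / 2) * D.R m n ^ s) * D.d j) := by
          gcongr
          refine (hf j).trans ?_
          gcongr
      _ = B * (D.R m (j + 1) ^ (-D.ν) * D.R m (j + 1) ^ (D.ν / 2) * D.d j) := by
          rw [hB]
          ring
      _ = _ := by rw [h2]
  have hbsum : Summable fun j => B * (D.R m (j + 1) ^ (-(D.ν / 2)) * D.d j) :=
    (hsum m).1.mul_left B
  have hsummable : Summable fun j => D.G m j (f j) := by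
    obtain ⟨α, β, hα, -, hp⟩ := D.equiv_norm m
    refine Summable.of_norm_bounded (hbsum.mul_left α⁻¹) fun j => ?_
    rw [inv_mul_eq_div, le_div_iff₀' hα]
    exact ((hp _).1).trans (hterm j)
  refine ⟨hsummable, ?_⟩
  refine (Seminorm.tsum_le_tsum (D.continuous_p m) hsummable hbsum hterm).trans ?_
  rw [tsum_mul_left]
  calc B * ∑' j, D.R m (j + 1) ^ (-(D.ν / 2)) * D.d j ≤ B * S :=
        mul_le_mul_of_nonneg_left (hsum m).2 hB0
    _ = _ := by rw [hB]; ring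

lemma green_succ {f : ℕ → X} {m : ℕ} (hf : Summable fun j => D.G m j (f j)) :
    D.green f (m + 1) = D.A m (D.green f m) + f m := by
  have h1 : ∀ j, D.G (m + 1) j (f j) = D.A m (D.G m j (f j)) + if j = m then f m else 0 := by
    intro j
    split_ifs with h
    · rw [h, D.G_succ_self]
    · rw [D.G_succ m j _ h, add_zero]
  have h2 : Summable fun j => D.A m (D.G m j (f j)) :=
    ((D.A m).summable).2 hf
  have h3 : Summable fun j => if j = m then f m else 0 :=
    summable_of_ne_finset_zero (s := {m}) fun j hj => if_neg (by simpa using hj)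
  rw [green, green, tsum_congr h1, h2.tsum_add h3, (D.A m).map_tsum, tsum_ite_eq]

lemma green_sub {f f' : ℕ → X} {m : ℕ} (hf : Summable fun j => D.G m j (f j))
    (hf' : Summable fun j => D.G m j (f' j)) :
    D.green (fun j => f j - f' j) m = D.green f m - D.green f' m := by
  simp only [green, map_sub]
  exact hf.tsum_sub hf'

lemma eq_Φ_of_isTraj {x : ℕ → X} (hx : ∀ m, x (m + 1) = D.A m (x m)) (m n : ℕ) :
    x m = D.Φ m n (x n) :=
  congr_fun (eq_of_recurrence (F := fun m => D.A m) (y' := fun m => D.Φ m n (x n))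
    (fun m => (D.A m).injective) hx (fun m => D.Φ_succ m n (x n)) (D.Φ_self n (x n)).symm) m

lemma variation_of_constants {e f : ℕ → X} (he : ∀ m, e (m + 1) = D.A m (e m) + f m) (m n : ℕ) :
    e m = D.Φ m n (e n) + ∑ j ∈ Finset.Ico n m, D.Φ m (j + 1) (f j)
      - ∑ j ∈ Finset.Ico m n, D.Φ m (j + 1) (f j) := by
  rcases le_total n m with h | h
  · rw [Finset.Ico_eq_empty_of_le h, Finset.sum_empty, sub_zero]
    induction m, h using Nat.le_induction with
    | base => simp [D.Φ_self]
    | succ m h ih =>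
      rw [he, Finset.sum_Ico_succ_top h, D.Φ_self, ← add_assoc, D.Φ_succ]
      congr 1
      conv_lhs => rw [ih]
      rw [map_add, map_sum]
      simp only [D.Φ_succ]
  · rw [Finset.Ico_eq_empty_of_le h, Finset.sum_empty, add_zero]
    induction h using Nat.decreasingInduction with
    | self => simp [D.Φ_self]
    | of_succ m h ih =>
      apply (D.A m).injective
      rw [eq_sub_of_add_eq (he m).symm, ih, Finset.sum_eq_sum_Ico_succ_bot h, map_sub, map_add,
        map_sum, D.Φ_succ]
      simp only [← D.Φ_succ]
      rw [D.Φ_self]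
      abel

lemma p_le_of_variation {e f : ℕ → X} (he : ∀ m, e (m + 1) = D.A m (e m) + f m) (m n : ℕ) :
    D.p m (e m) ≤ D.K * D.R m n ^ D.a * D.p n (e n)
      + ∑ j ∈ Finset.Ico n m ∪ Finset.Ico m n,
          D.K * D.R m (j + 1) ^ D.a * D.p (j + 1) (f j) := by
  have hsum : ∀ s : Finset ℕ, D.p m (∑ j ∈ s, D.Φ m (j + 1) (f j)) ≤
      ∑ j ∈ s, D.K * D.R m (j + 1) ^ D.a * D.p (j + 1) (f j) := fun s =>
    (Finset.le_sum_of_subadditive (D.p m) (map_zero _).le (map_add_le_add _) s _).trans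
      (Finset.sum_le_sum fun j _ => D.Φ_le m (j + 1) (f j))
  have hdisj : Disjoint (Finset.Ico n m) (Finset.Ico m n) := by
    rw [Finset.disjoint_left]
    intro j h1 h2
    rw [Finset.mem_Ico] at h1 h2
    omega
  rw [Finset.sum_union hdisj]
  conv_lhs => rw [D.variation_of_constants he m n]
  have h1 := map_sub_le_add (D.p m)
    (D.Φ m n (e n) + ∑ j ∈ Finset.Ico n m, D.Φ m (j + 1) (f j))
    (∑ j ∈ Finset.Ico m n, D.Φ m (j + 1) (f j))
  have h2 := map_add_le_add (D.p m) (D.Φ m n (e n))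
    (∑ j ∈ Finset.Ico n m, D.Φ m (j + 1) (f j))
  have h3 := D.Φ_le m n (e n)
  have h4 := hsum (Finset.Ico n m)
  have h5 := hsum (Finset.Ico m n)
  simp only [R] at *
  linarith

/-- Polynomial growth, in both time directions, of differences of perturbed trajectories. -/
lemma exists_growth_bound :
    ∃ c₁ : ℝ, 0 < c₁ ∧ ∀ (c : ℝ) (e f : ℕ → X), 0 ≤ c → c ≤ c₁ →
      (∀ m, e (m + 1) = D.A m (e m) + f m) →
      (∀ j, D.p (j + 1) (f j) ≤ c * D.d j * D.p j (e j)) →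
      ∀ m n, D.p m (e m) ≤ 2 * D.K * D.p n (e n) * D.R m n ^ (D.a + 1) := by
  obtain ⟨S, hS, hsum⟩ := exists_symRatio_sum_bound D.pos D.mono D.ratio_le one_pos
  have hθ0 : 0 < D.θ := zero_lt_one.trans_le D.one_le_θ
  have hK := D.K_pos
  have ha := D.a_pos
  refine ⟨1 / (2 * (D.K * D.θ ^ (D.a + 1) * S)), by positivity, fun c e f hc hc₁ he hf => ?_⟩
  rw [le_div_iff₀ (by positivity)] at hc₁
  intro m n
  have hn0 : 0 ≤ D.p n (e n) := apply_nonneg _ _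
  have key := le_of_forall_bootstrap (s := Set.Iic (max m n)) (e := fun i => D.p i (e i))
    (w := fun i => D.R i n ^ (D.a + 1)) (C := D.K * D.p n (e n))
    (L₀ := ∑ i ∈ Finset.Iic (max m n), D.p i (e i))
    (fun i _ => Real.rpow_nonneg (D.R_pos i n).le _) (by positivity)
    (Finset.sum_nonneg fun i _ => apply_nonneg _ _) ?_ ?_ m (le_max_left m n)
  · simpa [mul_assoc] using key
  · intro i hi
    have h1 : D.p i (e i) ≤ ∑ i ∈ Finset.Iic (max m n), D.p i (e i) :=
      Finset.single_le_sum (f := fun i => D.p i (e i)) (fun i _ => apply_nonneg _ _)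
        (Finset.mem_Iic.2 hi)
    have h2 : 1 ≤ D.R i n ^ (D.a + 1) := Real.one_le_rpow (D.one_le_R i n) (by linarith)
    exact h1.trans (le_mul_of_one_le_right ((apply_nonneg _ _).trans h1) h2)
  · intro L hL hbound i hi
    have hRi := D.R_pos i n
    refine (D.p_le_of_variation he i n).trans ?_
    have h1 : D.R i n ^ D.a ≤ D.R i n ^ (D.a + 1) :=
      Real.rpow_le_rpow_of_exponent_le (D.one_le_R i n) (by linarith)
    set W : ℝ := D.K * c * L * D.θ ^ (D.a + 1) * D.R i n ^ (D.a + 1) with hW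
    have hW0 : 0 ≤ W := by positivity
    have hterm : ∀ j ∈ Finset.Ico n i ∪ Finset.Ico i n,
        D.K * D.R i (j + 1) ^ D.a * D.p (j + 1) (f j) ≤
          W * (D.R i (j + 1) ^ (-1 : ℝ) * D.d j) := by
      intro j hj
      have hd := D.d_nonneg j
      have hR := D.R_pos i (j + 1)
      have hRj := D.R_pos j n
      rw [Finset.mem_union, Finset.mem_Ico, Finset.mem_Ico] at hj
      have hj' : j ∈ Set.Iic (max m n) := by
        have : i ≤ max m n := hi
        simp only [Set.mem_Iic]
        omega
      have h2 : D.R j n * D.R i (j + 1) ≤ D.θ * D.R i n :=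
        symRatio_mul_le_of_between D.pos D.mono D.ratio_le hj
      have h3 : D.R i (j + 1) ^ D.a * D.R j n ^ (D.a + 1) ≤
          D.θ ^ (D.a + 1) * D.R i n ^ (D.a + 1) * D.R i (j + 1) ^ (-1 : ℝ) := by
        have h4 : D.R i (j + 1) ^ D.a
            = D.R i (j + 1) ^ (D.a + 1) * D.R i (j + 1) ^ (-1 : ℝ) := by
          rw [← Real.rpow_add hR]
          congr 1
          ring
        calc D.R i (j + 1) ^ D.a * D.R j n ^ (D.a + 1)
            = (D.R j n * D.R i (j + 1)) ^ (D.a + 1) * D.R i (j + 1) ^ (-1 : ℝ) := by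
              rw [h4, Real.mul_rpow hRj.le hR.le]
              ring
          _ ≤ (D.θ * D.R i n) ^ (D.a + 1) * D.R i (j + 1) ^ (-1 : ℝ) := by gcongr
          _ = _ := by rw [Real.mul_rpow hθ0.le hRi.le]
      calc D.K * D.R i (j + 1) ^ D.a * D.p (j + 1) (f j)
          ≤ D.K * D.R i (j + 1) ^ D.a * (c * D.d j * (L * D.R j n ^ (D.a + 1))) := by
            gcongr
            refine (hf j).trans ?_
            gcongr
            exact hbound j hj'
        _ = D.K * c * L * D.d j * (D.R i (j + 1) ^ D.a * D.R j n ^ (D.a + 1)) := by ring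
        _ ≤ D.K * c * L * D.d j *
            (D.θ ^ (D.a + 1) * D.R i n ^ (D.a + 1) * D.R i (j + 1) ^ (-1 : ℝ)) := by gcongr
        _ = W * (D.R i (j + 1) ^ (-1 : ℝ) * D.d j) := by
            rw [hW]
            ring
    have h5 : ∑ j ∈ Finset.Ico n i ∪ Finset.Ico i n,
        D.R i (j + 1) ^ (-1 : ℝ) * D.d j ≤ S :=
      ((hsum i).1.sum_le_tsum _ fun j _ =>
        mul_nonneg (Real.rpow_nonneg (D.R_pos _ _).le _) (D.d_nonneg j)).trans (hsum i).2
    have h6 := Finset.sum_le_sum hterm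
    rw [← Finset.mul_sum] at h6
    have h7 : W * S ≤ L / 2 * D.R i n ^ (D.a + 1) := by
      have h8 : 0 ≤ L / 2 * D.R i n ^ (D.a + 1) := by positivity
      calc W * S = c * (2 * (D.K * D.θ ^ (D.a + 1) * S)) * (L / 2 * D.R i n ^ (D.a + 1)) := by
            rw [hW]
            ring
        _ ≤ 1 * (L / 2 * D.R i n ^ (D.a + 1)) := mul_le_mul_of_nonneg_right hc₁ h8
        _ = _ := one_mul _
    have h9 := mul_le_mul_of_nonneg_left h5 hW0
    have h10 : D.K * D.R i n ^ D.a * D.p n (e n) ≤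
        D.K * D.p n (e n) * D.R i n ^ (D.a + 1) := by
      rw [mul_right_comm]
      gcongr
    calc _ ≤ D.K * D.p n (e n) * D.R i n ^ (D.a + 1) + L / 2 * D.R i n ^ (D.a + 1) := by
          linarith
      _ = _ := by ring

lemma p_symm_le (n : ℕ) (w : X) :
    D.p n ((D.A n).symm w) ≤ D.K * D.θ ^ D.a * D.p (n + 1) w := by
  have h1 : (D.A n).symm w = D.Φ n (n + 1) w := by
    rw [ContinuousLinearEquiv.symm_apply_eq, ← D.Φ_succ, D.Φ_self]
  have hK := D.K_pos
  rw [h1]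
  refine (D.Φ_le n (n + 1) w).trans ?_
  have h2 : symRatio D.μ n (n + 1) ^ D.a ≤ D.θ ^ D.a :=
    Real.rpow_le_rpow (D.R_pos n (n + 1)).le (symRatio_succ_le D.pos D.mono D.ratio_le n)
      D.a_pos.le
  gcongr

/-- A perturbation of an invertible step with small Lipschitz constant is bijective. -/
lemma bijective_add [CompleteSpace X] {n : ℕ} {c : ℝ} (hc : 0 ≤ c)
    (hc' : D.K * D.θ ^ D.a * (c * D.θ) ≤ 1 / 2) {g : X → X}
    (hg : ∀ x y, D.p (n + 1) (g x - g y) ≤ c * D.d n * D.p n (x - y)) :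
    Function.Bijective fun x => D.A n x + g x := by
  have hK := D.K_pos
  have hθ0 : 0 < D.θ := zero_lt_one.trans_le D.one_le_θ
  have hlip : ∀ x y, D.p n ((D.A n).symm (g x - g y)) ≤ D.p n (x - y) / 2 := fun x y => by
    have hp : 0 ≤ D.p n (x - y) := apply_nonneg _ _
    calc D.p n ((D.A n).symm (g x - g y))
        ≤ D.K * D.θ ^ D.a * (c * D.θ * D.p n (x - y)) := by
          refine (D.p_symm_le n _).trans ?_
          gcongr
          refine (hg x y).trans ?_
          gcongr
          exact D.d_le n
      _ = D.K * D.θ ^ D.a * (c * D.θ) * D.p n (x - y) := by ring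
      _ ≤ 1 / 2 * D.p n (x - y) := by gcongr
      _ = _ := by ring
  constructor
  · intro x y hxy
    have h1 : x - y = -(D.A n).symm (g x - g y) := by
      apply (D.A n).injective
      rw [map_neg, ContinuousLinearEquiv.apply_symm_apply, map_sub, neg_sub,
        sub_eq_sub_iff_add_eq_add]
      simpa [add_comm] using hxy
    have h2 := hlip x y
    have h3 : D.p n (x - y) = D.p n ((D.A n).symm (g x - g y)) := by
      conv_lhs => rw [h1]
      exact map_neg_eq_map _ _
    exact D.eq_of_p_nonpos (n := n) (by linarith)
  · intro z
    obtain ⟨v, hv⟩ := exists_fixed_family (ι := Unit) (fun _ => D.p n)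
      (fun _ => D.equiv_norm n) (fun v _ => (D.A n).symm (z - g (v ()))) _ (fun _ => le_rfl)
      (fun v w b hvw _ => by
        rw [← map_sub, sub_sub_sub_cancel_left]
        refine (hlip _ _).trans ?_
        rw [map_sub_rev]
        linarith [hvw ()])
    have h1 : (D.A n).symm (z - g (v ())) = v () := congr_fun hv ()
    refine ⟨v (), ?_⟩
    rw [ContinuousLinearEquiv.symm_apply_eq] at h1
    simp only
    rw [← h1, sub_add_cancel]

lemma le_add_rpow {u t e c b ρ : ℝ} (hc : 0 ≤ c) (hb : 0 ≤ b) (ht : 0 ≤ t) (he : 0 ≤ e)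
    (hρ : 0 ≤ ρ) (hρ1 : ρ ≤ 1) (h1 : u ≤ b) (h2 : u ≤ c * (t + e)) :
    u ≤ (b + c) * t ^ ρ + c * e := by
  have hce : 0 ≤ c * e := mul_nonneg hc he
  have htρ : 0 ≤ t ^ ρ := Real.rpow_nonneg ht ρ
  rcases le_total t 1 with h | h
  · have h3 : t ≤ t ^ ρ := by
      rcases ht.eq_or_lt with rfl | ht0
      · exact htρ
      · simpa using Real.rpow_le_rpow_of_exponent_ge ht0 h hρ1
    nlinarith [mul_nonneg hb htρ, mul_le_mul_of_nonneg_left h3 hc]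
  · have h3 : 1 ≤ t ^ ρ := Real.one_le_rpow h hρ
    nlinarith [mul_nonneg hc htρ, mul_le_mul_of_nonneg_left h3 hb]

theorem exists_linearization [CompleteSpace X] {M : ℝ} (hM : 0 < M) :
    ∃ c₀ : ℝ, 0 < c₀ ∧ ∀ (g : ℕ → X → X) (c : ℝ), 0 < c → c ≤ c₀ →
      (∀ n x, D.p (n + 1) (g n x) ≤ M * D.d n) →
      (∀ n x y, D.p (n + 1) (g n x - g n y) ≤ c * D.d n * D.p n (x - y)) →
      ∃ h : ℕ → X ≃ₜ X,
        (∀ n x, h (n + 1) (D.A n x + g n x) = D.A n (h n x)) ∧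
        (∃ B : ℝ, 0 < B ∧ ∀ n x,
          D.p n (h n x - x) ≤ B ∧ D.p n ((h n).symm x - x) ≤ B) ∧
        ∃ C ρ : ℝ, 0 < C ∧ 0 < ρ ∧ ∀ n x y, D.p n (x - y) ≤ 1 →
          D.p n (h n x - h n y) ≤ C * D.p n (x - y) ^ ρ ∧
          D.p n ((h n).symm x - (h n).symm y) ≤ C * D.p n (x - y) ^ ρ := by
  obtain ⟨Q, hQ, hgreen⟩ := D.exists_green_bound
  obtain ⟨c₁, hc₁, hgrowth⟩ := D.exists_growth_bound
  have hK := D.K_pos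
  have hθ0 : 0 < D.θ := zero_lt_one.trans_le D.one_le_θ
  have ha := D.a_pos
  have hν := D.ν_pos
  refine ⟨min c₁ (min (1 / (2 * Q)) (1 / (2 * (D.K * D.θ ^ D.a * D.θ)))), by positivity, ?_⟩
  intro g c hc hcc hgM hgL
  rw [le_min_iff, le_min_iff, le_div_iff₀ (by positivity), le_div_iff₀ (by positivity)] at hcc
  obtain ⟨hcc₁, hcQ, hcF⟩ := hcc
  -- the perturbed maps as bijections, and their trajectories
  have hbij : ∀ n, Function.Bijective fun x => D.A n x + g n x := fun n =>
    D.bijective_add hc.le (by linarith) (hgL n)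
  have htraj : ∀ n y, ∃ Y : ℕ → X, (∀ m, Y (m + 1) = D.A m (Y m) + g m (Y m)) ∧ Y n = y := by
    intro n
    suffices h : ∀ y, ∃ y₀, (Nat.rec y₀ (fun m x => D.A m x + g m x) n : X) = y by
      intro y
      obtain ⟨y₀, hy₀⟩ := h y
      exact ⟨fun m => Nat.rec y₀ (fun m x => D.A m x + g m x) m, fun m => rfl, hy₀⟩
    induction n with
    | zero => exact fun y => ⟨y, rfl⟩
    | succ n ih =>
      intro y
      obtain ⟨x, hx⟩ := (hbij n).2 y
      obtain ⟨y₀, hy₀⟩ := ih x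
      exact ⟨y₀, by rw [← hx, ← hy₀]⟩
  choose Ψ hΨ hΨn using htraj
  have hΨ_unique : ∀ (Y : ℕ → X), (∀ m, Y (m + 1) = D.A m (Y m) + g m (Y m)) →
      ∀ n, Ψ n (Y n) = Y := fun Y hY n =>
    eq_of_recurrence (F := fun m x => D.A m x + g m x) (fun m => (hbij m).1) (hΨ n (Y n)) hY
      (hΨn n (Y n))
  -- bounds for the Green operator applied to the nonlinearity along arbitrary sequences
  have hsuper : ∀ (Y : ℕ → X) m, Summable (fun j => D.G m j (g j (Y j))) ∧
      D.p m (D.green (fun j => g j (Y j)) m) ≤ Q * M := by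
    intro Y m
    have := hgreen 0 M le_rfl (by positivity) hM.le 0 (fun j => g j (Y j))
      (fun j => by simpa using hgM j (Y j)) m
    simpa using this
  have hdiff : ∀ (Y Y' : ℕ → X) (s C : ℝ) (n : ℕ), 0 ≤ s → s ≤ D.ν / 2 → 0 ≤ C →
      (∀ j, D.p (j + 1) (g j (Y j) - g j (Y' j)) ≤ C * D.R j n ^ s * D.d j) →
      ∀ m, D.p m (D.green (fun j => g j (Y j)) m - D.green (fun j => g j (Y' j)) m) ≤
        Q * C * D.R m n ^ s := by
    intro Y Y' s C n hs hs' hC h m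
    rw [← D.green_sub (hsuper Y m).1 (hsuper Y' m).1]
    exact (hgreen s C hs hs' hC n _ h m).2
  have hcontr : ∀ (x v w : ℕ → X) (b : ℝ), (∀ i, D.p i (v i - w i) ≤ b) → ∀ i,
      D.p i (D.green (fun j => g j (x j + v j)) i - D.green (fun j => g j (x j + w j)) i)
        ≤ b / 2 := by
    intro x v w b hb i
    have hb0 : 0 ≤ b := (apply_nonneg _ _).trans (hb 0)
    have h1 := hdiff (fun j => x j + v j) (fun j => x j + w j) 0 (c * b) 0 le_rfl (by positivity)
      (by positivity) (fun j => by
        have hd := D.d_nonneg j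
        refine (hgL j _ _).trans ?_
        rw [add_sub_add_left_eq_sub, Real.rpow_zero, mul_one, mul_right_comm c b]
        gcongr
        exact hb j) i
    rw [Real.rpow_zero, mul_one] at h1
    nlinarith
  have hfix : ∀ x : ℕ → X, ∃ v : ℕ → X, (fun i => D.green (fun j => g j (x j + v j)) i) = v :=
    fun x => exists_fixed_family D.p D.equiv_norm
      (fun v i => D.green (fun j => g j (x j + v j)) i) (Q * M)
      (fun i => (hsuper _ i).2) (hcontr x)
  choose V hV using hfix
  have hV' : ∀ x i, D.green (fun j => g j (x j + V x j)) i = V x i := fun x i =>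
    congr_fun (hV x) i
  have hVbd : ∀ x i, D.p i (V x i) ≤ Q * M := fun x i => by
    rw [← hV' x i]
    exact (hsuper _ i).2
  have hV_unique : ∀ x v : ℕ → X, (∀ i, D.green (fun j => g j (x j + v j)) i = v i) →
      V x = v := by
    intro x v hv
    have hvbd : ∀ i, D.p i (v i) ≤ Q * M := fun i => by
      rw [← hv i]
      exact (hsuper _ i).2
    have key := le_of_forall_bootstrap (s := Set.univ) (e := fun i => D.p i (V x i - v i))
      (w := fun _ => 1) (C := 0) (L₀ := 2 * (Q * M)) (fun _ _ => zero_le_one) le_rfl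
      (by positivity) (fun i _ => by
        have := map_sub_le_add (D.p i) (V x i) (v i)
        linarith [hvbd i, hVbd x i])
      (fun L _ hb i _ => by
        have := hcontr x (V x) v L (fun i => by simpa using hb i (Set.mem_univ i)) i
        rw [hV', hv] at this
        simpa using this)
    funext i
    exact D.eq_of_p_nonpos (n := i) (by simpa using key i (Set.mem_univ i))
  -- the conjugacies
  let H : ℕ → X → X := fun n y => y - D.green (fun j => g j (Ψ n y j)) n
  let H' : ℕ → X → X := fun n x => x + V (fun m => D.Φ m n x) n
  have hleft : ∀ n y, H' n (H n y) = y := by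
    intro n y
    set v : ℕ → X := fun m => D.green (fun j => g j (Ψ n y j)) m with hv
    have hlin : ∀ m, Ψ n y (m + 1) - v (m + 1) = D.A m (Ψ n y m - v m) := fun m => by
      rw [hΨ, hv]
      simp only
      rw [D.green_succ (hsuper _ m).1, map_sub]
      abel
    have hH : H n y = Ψ n y n - v n := by rw [hΨn]
    have hx : (fun m => D.Φ m n (H n y)) = fun m => Ψ n y m - v m := by
      funext m
      rw [hH]
      exact (D.eq_Φ_of_isTraj (x := fun m => Ψ n y m - v m) hlin m n).symm
    have hVv : V (fun m => D.Φ m n (H n y)) = v := by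
      rw [hx]
      exact hV_unique _ _ fun i => by simp only [sub_add_cancel, hv]
    change H n y + V (fun m => D.Φ m n (H n y)) n = y
    rw [hVv, hH, sub_add_cancel, hΨn]
  have hright : ∀ n x, H n (H' n x) = x := by
    intro n x
    set ξ : ℕ → X := fun m => D.Φ m n x with hξ
    have hY : ∀ m, ξ (m + 1) + V ξ (m + 1)
        = D.A m (ξ m + V ξ m) + g m (ξ m + V ξ m) := fun m => by
      rw [← hV' ξ (m + 1), D.green_succ (hsuper _ m).1, hV', map_add]
      simp only [hξ, D.Φ_succ]
      abel
    have hH' : H' n x = ξ n + V ξ n := by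
      simp only [H', hξ, D.Φ_self]
    have hΨ' : Ψ n (H' n x) = fun m => ξ m + V ξ m := by
      rw [hH']
      exact hΨ_unique (fun m => ξ m + V ξ m) hY n
    change H' n x - D.green (fun j => g j (Ψ n (H' n x) j)) n = x
    rw [hΨ', hV', hH', add_sub_cancel_right, hξ]
    exact D.Φ_self n x
  have hconj : ∀ n x, H (n + 1) (D.A n x + g n x) = D.A n (H n x) := by
    intro n x
    have h1 : D.A n x + g n x = Ψ n x (n + 1) := by rw [hΨ, hΨn]
    have h2 : Ψ (n + 1) (D.A n x + g n x) = Ψ n x := by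
      rw [h1]
      exact hΨ_unique _ (hΨ n x) (n + 1)
    change D.A n x + g n x - D.green (fun j => g j (Ψ (n + 1) (D.A n x + g n x) j)) (n + 1)
      = D.A n (x - D.green (fun j => g j (Ψ n x j)) n)
    rw [h2, D.green_succ (hsuper _ n).1, hΨn, map_sub]
    abel
  -- Hölder estimates
  set b : ℝ := D.a + 1 with hb
  have hb1 : 1 ≤ b := by linarith
  obtain ⟨ρ, hρ, hρ1, hρν⟩ : ∃ ρ : ℝ, 0 < ρ ∧ ρ ≤ 1 ∧ b * ρ ≤ D.ν / 2 := by
    refine ⟨min 1 (D.ν / 2 / b), by positivity, min_le_left _ _, ?_⟩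
    calc b * min 1 (D.ν / 2 / b) ≤ b * (D.ν / 2 / b) := by
          gcongr
          exact min_le_right _ _
      _ = D.ν / 2 := by field_simp
  set C₁ : ℝ := (2 * M + c) * (2 * D.K) ^ ρ with hC₁
  have hC₁0 : 0 < C₁ := by positivity
  have hlocal : ∀ (Y Y' : ℕ → X) (n j : ℕ) (t e Δ : ℝ), 0 ≤ Δ → 0 ≤ t → 0 ≤ e →
      t ≤ 2 * D.K * Δ * D.R j n ^ b → D.p j (Y j - Y' j) ≤ t + e →
      D.p (j + 1) (g j (Y j) - g j (Y' j)) ≤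
        (C₁ * Δ ^ ρ * D.R j n ^ (b * ρ) + c * e) * D.d j := by
    intro Y Y' n j t e Δ hΔ ht he htb hYt
    have hd := D.d_nonneg j
    have hR := D.R_pos j n
    have h1 : D.p j (Y j - Y' j) ≤ t + e := hYt
    have h2 : D.p (j + 1) (g j (Y j) - g j (Y' j)) ≤ min (2 * M) (c * (t + e)) * D.d j := by
      rw [min_mul_of_nonneg _ _ hd]
      refine le_min ?_ ?_
      · have := map_sub_le_add (D.p (j + 1)) (g j (Y j)) (g j (Y' j))
        linarith [hgM j (Y j), hgM j (Y' j)]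
      · refine (hgL j _ _).trans ?_
        rw [mul_right_comm]
        gcongr
    refine h2.trans (mul_le_mul_of_nonneg_right ?_ hd)
    refine (le_add_rpow hc.le (by positivity : (0 : ℝ) ≤ 2 * M) ht he hρ.le hρ1
      (min_le_left _ _) (min_le_right _ _)).trans ?_
    have h3 : t ^ ρ ≤ (2 * D.K) ^ ρ * Δ ^ ρ * D.R j n ^ (b * ρ) := by
      refine (Real.rpow_le_rpow ht htb hρ.le).trans_eq ?_
      rw [Real.mul_rpow (by positivity) (by positivity), Real.mul_rpow (by positivity) hΔ,
        ← Real.rpow_mul hR.le]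
    calc (2 * M + c) * t ^ ρ + c * e
        ≤ (2 * M + c) * ((2 * D.K) ^ ρ * Δ ^ ρ * D.R j n ^ (b * ρ)) + c * e := by gcongr
      _ = _ := by rw [hC₁]; ring
  set C : ℝ := 1 + 2 * (Q * C₁) with hC
  have hbase : ∀ t : ℝ, 0 ≤ t → t ≤ 1 → t ≤ t ^ ρ := fun t ht ht1 => by
    rcases ht.eq_or_lt with rfl | ht0
    · exact Real.rpow_nonneg le_rfl _
    · simpa using Real.rpow_le_rpow_of_exponent_ge ht0 ht1 hρ1
  have hHolder : ∀ n x y, D.p n (x - y) ≤ 1 → D.p n (H n x - H n y) ≤ C * D.p n (x - y) ^ ρ := by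
    intro n x y hxy
    have hΔ : 0 ≤ D.p n (x - y) := apply_nonneg _ _
    have hgr := hgrowth c (fun m => Ψ n x m - Ψ n y m)
      (fun m => g m (Ψ n x m) - g m (Ψ n y m)) hc.le hcc₁
      (fun m => by
        rw [hΨ, hΨ, map_sub]
        abel)
      (fun j => hgL j _ _)
    replace hgr := fun m => hgr m n
    simp only [hΨn] at hgr
    have h1 := hdiff (Ψ n x) (Ψ n y) (b * ρ) (C₁ * D.p n (x - y) ^ ρ) n (by positivity) hρν
      (by positivity) (fun j => by
        simpa using hlocal (Ψ n x) (Ψ n y) n j _ 0 _ hΔ (apply_nonneg (D.p j) _) le_rfl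
          (hgr j) (by simp)) n
    rw [show D.R n n = 1 from symRatio_self D.pos n, Real.one_rpow, mul_one] at h1
    have h2 : H n x - H n y = (x - y) - (D.green (fun j => g j (Ψ n x j)) n
        - D.green (fun j => g j (Ψ n y j)) n) := by
      simp only [H]
      abel
    rw [h2]
    refine (map_sub_le_add (D.p n) _ _).trans ?_
    have h3 := hbase _ hΔ hxy
    have h4 : 0 ≤ Q * (C₁ * D.p n (x - y) ^ ρ) := by positivity
    calc _ ≤ D.p n (x - y) ^ ρ + Q * (C₁ * D.p n (x - y) ^ ρ) := add_le_add h3 h1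
      _ ≤ D.p n (x - y) ^ ρ + 2 * (Q * (C₁ * D.p n (x - y) ^ ρ)) := by linarith
      _ = _ := by rw [hC]; ring
  have hHolder' : ∀ n x y, D.p n (x - y) ≤ 1 →
      D.p n (H' n x - H' n y) ≤ C * D.p n (x - y) ^ ρ := by
    intro n x y hxy
    have hΔ : 0 ≤ D.p n (x - y) := apply_nonneg _ _
    set ξ : ℕ → X := fun m => D.Φ m n x with hξ
    set η : ℕ → X := fun m => D.Φ m n y with hη
    have hlin : ∀ j, D.p j (ξ j - η j) ≤ 2 * D.K * D.p n (x - y) * D.R j n ^ b := fun j => by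
      have hR := D.R_pos j n
      have h1 : D.R j n ^ D.a ≤ D.R j n ^ b :=
        Real.rpow_le_rpow_of_exponent_le (D.one_le_R j n) (by linarith)
      have h2 : 0 ≤ D.K * D.p n (x - y) * D.R j n ^ b := by positivity
      simp only [hξ, hη]
      rw [← map_sub]
      calc _ ≤ D.K * D.R j n ^ D.a * D.p n (x - y) := D.Φ_le j n (x - y)
        _ ≤ D.K * D.R j n ^ b * D.p n (x - y) := by gcongr
        _ ≤ _ := by linarith
    have hs0 : 0 ≤ b * ρ := by positivity
    have key := le_of_forall_bootstrap (s := Set.univ) (e := fun i => D.p i (V ξ i - V η i))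
      (w := fun i => D.R i n ^ (b * ρ)) (C := Q * (C₁ * D.p n (x - y) ^ ρ)) (L₀ := 2 * (Q * M))
      (fun i _ => Real.rpow_nonneg (D.R_pos i n).le _) (by positivity) (by positivity)
      (fun i _ => by
        have h1 := map_sub_le_add (D.p i) (V ξ i) (V η i)
        have h2 : 1 ≤ D.R i n ^ (b * ρ) := Real.one_le_rpow (D.one_le_R i n) hs0
        have h3 : 2 * (Q * M) ≤ 2 * (Q * M) * D.R i n ^ (b * ρ) :=
          le_mul_of_one_le_right (by positivity) h2
        linarith [hVbd ξ i, hVbd η i])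
      (fun L hL hbound i _ => by
        have h1 := hdiff (fun j => ξ j + V ξ j) (fun j => η j + V η j) (b * ρ)
          (C₁ * D.p n (x - y) ^ ρ + c * L) n hs0 hρν (by positivity) (fun j => by
            have hR := D.R_pos j n
            refine (hlocal (fun j => ξ j + V ξ j) (fun j => η j + V η j) n j
              (D.p j (ξ j - η j)) (L * D.R j n ^ (b * ρ)) _ hΔ (apply_nonneg _ _)
              (by positivity) (hlin j) ?_).trans_eq (by ring)
            rw [add_sub_add_comm]
            exact (map_add_le_add (D.p j) _ _).trans
              (add_le_add le_rfl (hbound j (Set.mem_univ j)))) i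
        rw [hV', hV'] at h1
        refine h1.trans (mul_le_mul_of_nonneg_right ?_ (Real.rpow_nonneg (D.R_pos i n).le _))
        nlinarith)
      n (Set.mem_univ n)
    rw [show D.R n n = 1 from symRatio_self D.pos n, Real.one_rpow, mul_one] at key
    have h2 : H' n x - H' n y = (x - y) + (V ξ n - V η n) := by
      simp only [H']
      abel
    rw [h2]
    refine (map_add_le_add (D.p n) _ _).trans ?_
    have h3 := hbase _ hΔ hxy
    calc _ ≤ D.p n (x - y) ^ ρ + 2 * (Q * (C₁ * D.p n (x - y) ^ ρ)) := add_le_add h3 key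
      _ = _ := by rw [hC]; ring
  have hcont : ∀ (f : ℕ → X → X), (∀ n x y, D.p n (x - y) ≤ 1 →
      D.p n (f n x - f n y) ≤ C * D.p n (x - y) ^ ρ) → ∀ n, Continuous (f n) := by
    intro f hf n
    obtain ⟨α, β, hα, -, hp⟩ := D.equiv_norm n
    exact continuous_of_holder hα hp hρ (hf n)
  refine ⟨fun n => ⟨⟨H n, H' n, hleft n, hright n⟩, hcont H hHolder n, hcont H' hHolder' n⟩,
    hconj, ⟨Q * M, by positivity, fun n x => ⟨?_, ?_⟩⟩, C, ρ, by positivity, hρ,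
    fun n x y hxy => ⟨hHolder n x y hxy, hHolder' n x y hxy⟩⟩
  · change D.p n (x - D.green (fun j => g j (Ψ n x j)) n - x) ≤ Q * M
    rw [sub_sub_cancel_left, map_neg_eq_map]
    exact (hsuper _ n).2
  · change D.p n (x + V (fun m => D.Φ m n x) n - x) ≤ Q * M
    rw [add_sub_cancel_left]
    exact hVbd _ n

end GreenData

end Green

section Evolution

variable (A : ℕ → X ≃L[ℝ] X)

lemma evolEquiv_self (n : ℕ) (x : X) : evolEquiv A n n x = x := by
  simp [evolEquiv, evolFwdE]

lemma evolFwdE_succ_apply (m n : ℕ) (x : X) :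
    evolFwdE A m (n + 1) x = evolFwdE A (m + 1) n (A m x) := by
  induction n with
  | zero => simp [evolFwdE]
  | succ n ih =>
    rw [evolFwdE, ContinuousLinearEquiv.trans_apply, ih, evolFwdE,
      ContinuousLinearEquiv.trans_apply, Nat.add_right_comm, add_assoc m n 1]

lemma evolEquiv_succ (m k : ℕ) (x : X) : evolEquiv A (m + 1) k x = A m (evolEquiv A m k x) := by
  rcases le_or_gt k m with h | h
  · obtain ⟨n, rfl⟩ := Nat.exists_eq_add_of_le h
    rw [evolEquiv, evolEquiv, if_pos (h.trans (Nat.le_succ _)), if_pos h, add_assoc,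
      Nat.add_sub_cancel_left, Nat.add_sub_cancel_left, evolFwdE,
      ContinuousLinearEquiv.trans_apply]
  · obtain ⟨n, rfl⟩ := Nat.exists_eq_add_of_lt h
    have h1 : evolEquiv A m (m + n + 1) = (evolFwdE A m (n + 1)).symm := by
      rw [evolEquiv, if_neg (not_le.2 h), add_assoc, Nat.add_sub_cancel_left]
    have h2 : evolEquiv A (m + 1) (m + n + 1) = (evolFwdE A (m + 1) n).symm := by
      rcases n.eq_zero_or_pos with rfl | hn
      · ext x
        simp [evolEquiv_self, evolFwdE]
      · rw [evolEquiv, if_neg (by omega), show m + n + 1 - (m + 1) = n by omega]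
    rw [h1, h2, ContinuousLinearEquiv.symm_apply_eq, ← evolFwdE_succ_apply,
      ContinuousLinearEquiv.apply_symm_apply]

end Evolution

/-- Theorem 5.1 (`NTL`), nonautonomous topological linearization. -/
theorem topological_linearization [CompleteSpace X]
    (μ : ℕ → ℝ) (hμ : IsGrowthRate μ) (θ : ℝ) (hθ : 1 ≤ θ)
    (hμr : ∀ n, μ (n + 1) / μ n ≤ θ)
    (A : ℕ → X ≃L[ℝ] X) (Nrm : ℕ → X → ℝ) (hNrm : IsNormFamily Nrm)
    (hEq : NormsEquivalent Nrm)
    (hdich : MuDichotomyNormsE μ A Nrm)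
    (K a : ℝ) (hK : 0 < K) (ha : 0 < a)
    (hfwd : ∀ k m : ℕ, 1 ≤ k → k ≤ m → ∀ x : X,
      Nrm m (evolE A m k x) ≤ K * (μ m / μ k) ^ a * Nrm k x)
    (hbwd : ∀ m k : ℕ, 1 ≤ m → m ≤ k → ∀ x : X,
      Nrm m (evolE A m k x) ≤ K * (μ k / μ m) ^ a * Nrm k x)
    (M : ℝ) (hM : 0 < M) :
    ∃ c₀ : ℝ, 0 < c₀ ∧ ∀ (g : ℕ → X → X) (c : ℝ), 0 < c → c ≤ c₀ →
      (∀ n, 1 ≤ n → ∀ x : X, Nrm (n + 1) (g n x) ≤ M * ((μ (n + 1) - μ n) / μ n)) →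
      (∀ n, 1 ≤ n → ∀ x y : X,
        Nrm (n + 1) (g n x - g n y) ≤ c * ((μ (n + 1) - μ n) / μ n) * Nrm n (x - y)) →
      ∃ h : ℕ → X ≃ₜ X,
        (∀ n, 1 ≤ n → ∀ x : X, h (n + 1) (A n x + g n x) = A n (h n x)) ∧
        (∃ D : ℝ, 0 < D ∧ ∀ n, 1 ≤ n → ∀ x : X,
          Nrm n (h n x - x) ≤ D ∧ Nrm n ((h n).symm x - x) ≤ D) ∧
        ∃ Kb ρ δ : ℝ, 0 < Kb ∧ 0 < ρ ∧ 0 < δ ∧ ∀ n, 1 ≤ n → ∀ x y : X,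
          Nrm n (x - y) ≤ δ →
            Nrm n (h n x - h n y) ≤ Kb * Nrm n (x - y) ^ ρ ∧
            Nrm n ((h n).symm x - (h n).symm y) ≤ Kb * Nrm n (x - y) ^ ρ := by
  obtain ⟨hμm, hμ0, -⟩ := hμ
  obtain ⟨P, -, -, -, N, ν, hN, hν, hs, hu⟩ := hdich
  have hpos : ∀ n, 0 < μ n := fun n => by
    have := hμm.monotone n.zero_le
    linarith
  let p : ℕ → Seminorm ℝ X := fun n =>
    Seminorm.of (Nrm (n + 1)) (hNrm (n + 1)).1 fun r x => (hNrm (n + 1)).2.1 r x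
  let D : GreenData X :=
    { A := fun n => A (n + 1)
      p := p
      Φ := fun m k => evolE A (m + 1) (k + 1)
      G := fun m j => if j < m then (evolE A (m + 1) (j + 2)).comp (P (j + 2))
        else -(evolE A (m + 1) (j + 2)).comp (ContinuousLinearMap.id ℝ X - P (j + 2))
      μ := fun n => μ (n + 1)
      θ := θ
      K := K
      a := a
      N := N
      ν := ν
      equiv_norm := fun i => hEq (i + 1)
      pos := fun n => hpos (n + 1)
      mono := fun i j h => hμm.monotone (Nat.succ_le_succ h)
      ratio_le := fun n => hμr (n + 1)
      K_pos := hK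
      a_pos := ha
      N_pos := by linarith
      ν_pos := hν
      Φ_self := fun n x => evolEquiv_self A (n + 1) x
      Φ_succ := fun m k x => evolEquiv_succ A (m + 1) (k + 1) x
      Φ_le := fun m k x => by
        rcases le_total k m with h | h
        · refine (hfwd (k + 1) (m + 1) k.succ_pos (Nat.succ_le_succ h) x).trans ?_
          refine mul_le_mul_of_nonneg_right (mul_le_mul_of_nonneg_left ?_ hK.le)
            (apply_nonneg (p k) x)
          exact Real.rpow_le_rpow (div_pos (hpos _) (hpos _)).le (le_max_left _ _) ha.le
        · refine (hbwd (m + 1) (k + 1) m.succ_pos (Nat.succ_le_succ h) x).trans ?_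
          refine mul_le_mul_of_nonneg_right (mul_le_mul_of_nonneg_left ?_ hK.le)
            (apply_nonneg (p k) x)
          exact Real.rpow_le_rpow (div_pos (hpos _) (hpos _)).le (le_max_right _ _) ha.le
      G_succ_self := fun m z => by
        have h1 : ∀ x, A (m + 1) (evolE A (m + 1) (m + 2) x) = x := fun x =>
          (evolEquiv_succ A (m + 1) (m + 2) x).symm.trans (evolEquiv_self A (m + 2) x)
        have h2 : ∀ x, evolE A (m + 1 + 1) (m + 2) x = x := evolEquiv_self A (m + 2)
        simp [h1, h2]
      G_succ := fun m j z hj => by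
        have h1 : ∀ x, evolE A (m + 1 + 1) (j + 2) x = A (m + 1) (evolE A (m + 1) (j + 2) x) :=
          evolEquiv_succ A (m + 1) (j + 2)
        by_cases h : j < m
        · simp [h, h.trans m.lt_succ_self, h1]
        · have h' : ¬ j < m + 1 := by omega
          simp [h, h', h1]
      G_le := fun m j z => by
        by_cases h : j < m
        · have h1 := hs (j + 2) (m + 1) (by omega) (by omega) z
          have h2 := symRatio_of_le (μ := fun n => μ (n + 1)) (fun n => hpos (n + 1))
            (fun i j h => hμm.monotone (Nat.succ_le_succ h)) (Nat.succ_le_of_lt h)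
          simp only [h, if_true]
          rw [h2]
          exact h1
        · have h1 := hu (m + 1) (j + 2) (by omega) (by omega) z
          have h2 := symRatio_of_le (μ := fun n => μ (n + 1)) (fun n => hpos (n + 1))
            (fun i j h => hμm.monotone (Nat.succ_le_succ h))
            (show m ≤ j + 1 by omega)
          simp only [h, if_false]
          rw [symRatio_comm, h2]
          rw [neg_apply, map_neg_eq_map]
          exact h1 }
  obtain ⟨c₀, hc₀, hmain⟩ := D.exists_linearization hM
  refine ⟨c₀, hc₀, fun g c hc hcc hgM hgL => ?_⟩
  obtain ⟨h, hconj, ⟨B, hB, hbd⟩, C, ρ, hC, hρ, hhol⟩ := hmain (fun n => g (n + 1)) c hc hcc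
    (fun n x => hgM (n + 1) n.succ_pos x) (fun n x y => hgL (n + 1) n.succ_pos x y)
  refine ⟨fun n => h (n - 1), ?_, ⟨B, hB, ?_⟩, C, ρ, 1, hC, hρ, one_pos, ?_⟩
  all_goals
    intro n hn
    obtain ⟨n, rfl⟩ := Nat.exists_eq_add_of_le' hn
  · exact hconj n
  · exact hbd n
  · exact hhol n

end
end

section
/- Let μ be a discrete growth rate with μ_{n+1}/μ_n ≤ θ for all n and some θ ≥ 1. Assume: (1) the system x_{n+1}=A_n x_n admits a strong nonuniform μ-dichotomy with nonuniformity exponent ε ≥ 0; (2) there exists M > 0 with ‖g_n(x)‖ ≤ M μ'_n μ_n^{−(1+ε)} for all n, x; (3) there exists c > 0 with ‖g_n(x)−g_n(y)‖ ≤ c μ'_n μ_n^{−(1+ε)} ‖x−y‖ for all n, x, y. Then, provided c is sufficiently small, there exists a sequence (h_n)_{n≥1} of homeomorphisms h_n : X → X such that: (a) h_{n+1}∘(A_n+g_n) = A_n∘h_n for all n; (b) there exists D > 0 with ‖h_n(x)−x‖ ≤ D and ‖h_n^{−1}(x)−x‖ ≤ D for all n, x; (c) there exist K̄, ϱ, δ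 > 0 such that ‖h_n(x)−h_n(y)‖ ≤ K̄ μ_n^{ϱε} ‖x−y‖^ϱ and ‖h_n^{−1}(x)−h_n^{−1}(y)‖ ≤ K̄ μ_n^{ϱε} ‖x−y‖^ϱ for all n and all x, y with ‖x−y‖ ≤ δ μ_n^{−ε}. -/
noncomputable section

open Filter Metric Set Topology

variable {X : Type*} [NormedAddCommGroup X] [NormedSpace ℝ X]

theorem le_two_mul_of_self_improving {ι : Type*} {s : Set ι} {e S : ι → ℝ} {a B : ℝ}
    (hS : ∀ j ∈ s, 0 < S j) (he : ∀ j ∈ s, 0 ≤ e j) (hB : ∀ j ∈ s, e j ≤ B * S j)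
    (h : ∀ t, 0 ≤ t → (∀ j ∈ s, e j ≤ t * S j) → ∀ j ∈ s, e j ≤ (a + t / 2) * S j) :
    ∀ j ∈ s, e j ≤ 2 * a * S j := by
  intro i hi
  have hbdd : BddAbove ((fun j => e j / S j) '' s) := by
    refine ⟨B, ?_⟩
    rintro _ ⟨j, hj, rfl⟩
    exact (div_le_iff₀ (hS j hj)).2 (hB j hj)
  set t := sSup ((fun j => e j / S j) '' s) with ht
  have hle : ∀ j ∈ s, e j / S j ≤ t := fun j hj => le_csSup hbdd ⟨j, hj, rfl⟩
  have hle' : ∀ j ∈ s, e j ≤ t * S j := fun j hj => (div_le_iff₀ (hS j hj)).1 (hle j hj)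
  have ht0 : 0 ≤ t := (div_nonneg (he i hi) (hS i hi).le).trans (hle i hi)
  have ht1 : t ≤ a + t / 2 := by
    refine csSup_le ⟨_, i, hi, rfl⟩ ?_
    rintro _ ⟨j, hj, rfl⟩
    exact (div_le_iff₀ (hS j hj)).2 (h t ht0 hle' j hj)
  exact (hle' i hi).trans (mul_le_mul_of_nonneg_right (by linarith) (hS i hi).le)

/-- The weight `max (e^{ℓ k} / e^{ℓ n}) (e^{ℓ n} / e^{ℓ k}) ^ b`. -/
def expWeight (ℓ : ℕ → ℝ) (b : ℝ) (k n : ℕ) : ℝ := Real.exp (b * |ℓ k - ℓ n|)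

theorem expWeight_pos (ℓ : ℕ → ℝ) (b : ℝ) (k n : ℕ) : 0 < expWeight ℓ b k n := Real.exp_pos _

@[simp]
theorem expWeight_self (ℓ : ℕ → ℝ) (b : ℝ) (n : ℕ) : expWeight ℓ b n n = 1 := by
  simp [expWeight]

theorem one_le_expWeight (ℓ : ℕ → ℝ) {b : ℝ} (hb : 0 ≤ b) (k n : ℕ) :
    1 ≤ expWeight ℓ b k n := Real.one_le_exp (by positivity)

theorem expWeight_triangle (ℓ : ℕ → ℝ) {b : ℝ} (hb : 0 ≤ b) (k m n : ℕ) :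
    expWeight ℓ b k n ≤ expWeight ℓ b k m * expWeight ℓ b m n := by
  rw [expWeight, expWeight, expWeight, ← Real.exp_add, ← mul_add]
  exact Real.exp_le_exp.2 (mul_le_mul_of_nonneg_left (abs_sub_le _ _ _) hb)

/-- Perturbations bounded by `M * ω k` and Lipschitz with constant `c * ω k`. -/
def IsBddLip (ω : ℕ → ℝ) (M c : ℝ) (f : ℕ → X → X) : Prop :=
  ∀ k, (∀ x, ‖f k x‖ ≤ M * ω k) ∧ ∀ x y, ‖f k x - f k y‖ ≤ c * ω k * ‖x - y‖

/-- Orbits of the maps `A k + f k`. -/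
def IsOrbit (A : ℕ → X ≃L[ℝ] X) (f : ℕ → X → X) (x : ℕ → X) : Prop :=
  ∀ k, x (k + 1) = A k (x k) + f k (x k)

/-- The sequences `x` and `x'` differ by the Green series of the forcing
`g k (x' k) - f k (x k)`. -/
def GreenRel (G : ℕ → ℕ → X →L[ℝ] X) (f g : ℕ → X → X) (x x' : ℕ → X) : Prop :=
  ∀ m, HasSum (fun k => G m k (g k (x' k) - f k (x k))) (x' m - x m)

/-- Weighted row sums of the kernel `G` are bounded by `C`. -/
def GreenBound (G : ℕ → ℕ → X →L[ℝ] X) (ω ℓ : ℕ → ℝ) (b C : ℝ) : Prop :=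
  ∀ m, Summable (fun k => ‖G m k‖ * ω k * expWeight ℓ b k m) ∧
    ∑' k, ‖G m k‖ * ω k * expWeight ℓ b k m ≤ C

theorem isBddLip_zero {Y : Type*} [NormedAddCommGroup Y]
    {ω : ℕ → ℝ} (hω : ∀ k, 0 ≤ ω k) {M c : ℝ} (hM : 0 ≤ M) (hc : 0 ≤ c) :
    IsBddLip ω M c (fun _ (_ : Y) => (0 : Y)) := by
  intro k
  have := hω k
  refine ⟨fun x => ?_, fun x y => ?_⟩
  · simpa using mul_nonneg hM this
  · simp only [sub_self, norm_zero]; positivity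

section Green

variable {G : ℕ → ℕ → X →L[ℝ] X} {ω ℓ : ℕ → ℝ} {b C M c : ℝ} {f g p : ℕ → X → X}

theorem GreenBound.nonneg (hG : GreenBound G ω ℓ b C) (hω : ∀ k, 0 ≤ ω k) : 0 ≤ C :=
  (tsum_nonneg fun k => mul_nonneg (mul_nonneg (norm_nonneg _) (hω k))
    (expWeight_pos ℓ b k 0).le).trans (hG 0).2

theorem GreenBound.norm_apply_le (hω : ∀ k, 0 ≤ ω k) (hb : 0 ≤ b) {q : ℕ → X} {T : ℝ}
    (hT : 0 ≤ T) {n : ℕ} (hq : ∀ k, ‖q k‖ ≤ ω k * T * expWeight ℓ b k n) (m k : ℕ) :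
    ‖G m k (q k)‖ ≤ ‖G m k‖ * ω k * expWeight ℓ b k m * (T * expWeight ℓ b m n) := by
  have hωk := hω k
  calc ‖G m k (q k)‖ ≤ ‖G m k‖ * ‖q k‖ := (G m k).le_opNorm _
    _ ≤ ‖G m k‖ * (ω k * T * (expWeight ℓ b k m * expWeight ℓ b m n)) := by
        gcongr
        exact (hq k).trans (by gcongr; exact expWeight_triangle ℓ hb k m n)
    _ = _ := by ring

theorem GreenBound.summable_apply [CompleteSpace X] (hG : GreenBound G ω ℓ b C)
    (hω : ∀ k, 0 ≤ ω k) (hb : 0 ≤ b)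
    {q : ℕ → X} {T : ℝ} (hT : 0 ≤ T) {n : ℕ} (hq : ∀ k, ‖q k‖ ≤ ω k * T * expWeight ℓ b k n)
    (m : ℕ) : Summable fun k => G m k (q k) :=
  .of_norm_bounded ((hG m).1.mul_right _) fun k => GreenBound.norm_apply_le hω hb hT hq m k

theorem GreenBound.norm_le (hG : GreenBound G ω ℓ b C) (hω : ∀ k, 0 ≤ ω k) (hb : 0 ≤ b)
    {q : ℕ → X} {T : ℝ} (hT : 0 ≤ T) {n : ℕ} (hq : ∀ k, ‖q k‖ ≤ ω k * T * expWeight ℓ b k n)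
    {m : ℕ} {z : X} (hz : HasSum (fun k => G m k (q k)) z) :
    ‖z‖ ≤ C * T * expWeight ℓ b m n := by
  have hs := (hG m).1.mul_right (T * expWeight ℓ b m n)
  have hpos := expWeight_pos ℓ b m n
  calc ‖z‖ ≤ ∑' k, ‖G m k‖ * ω k * expWeight ℓ b k m * (T * expWeight ℓ b m n) := by
        rw [← hz.tsum_eq]
        exact tsum_of_norm_bounded hs.hasSum fun k =>
          GreenBound.norm_apply_le hω hb hT hq m k
    _ = (∑' k, ‖G m k‖ * ω k * expWeight ℓ b k m) * (T * expWeight ℓ b m n) := tsum_mul_right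
    _ ≤ C * (T * expWeight ℓ b m n) := by gcongr; exact (hG m).2
    _ = _ := by ring

theorem IsBddLip.norm_sub_le {Y : Type*} [NormedAddCommGroup Y] {f g : ℕ → Y → Y}
    (hf : IsBddLip ω M c f) (hg : IsBddLip ω M c g) (k : ℕ) (x y : Y) :
    ‖g k x - f k y‖ ≤ 2 * M * ω k :=
  (_root_.norm_sub_le _ _).trans (by linarith [(hg k).1 x, (hf k).1 y])

theorem GreenRel.symm {x x' : ℕ → X} (h : GreenRel G f g x x') : GreenRel G g f x' x := by
  intro m
  have := (h m).neg
  simpa only [← map_neg, neg_sub] using this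

theorem GreenRel.trans {x x' x'' : ℕ → X} (h : GreenRel G f g x x')
    (h' : GreenRel G g p x' x'') : GreenRel G f p x x'' := by
  intro m
  have := (h' m).add (h m)
  simpa only [← map_add, sub_add_sub_cancel] using this

theorem GreenRel.isOrbit {A : ℕ → X ≃L[ℝ] X}
    (hrec : ∀ m k, G (m + 1) k = (A m : X →L[ℝ] X).comp (G m k) + if k = m then 1 else 0)
    {x x' : ℕ → X} (h : GreenRel G f g x x') (hx : IsOrbit A f x) : IsOrbit A g x' := by
  intro m
  have h1 := ((h m).mapL (A m : X →L[ℝ] X)).add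
    (hasSum_ite_eq m (g m (x' m) - f m (x m)))
  have h2 := (h (m + 1)).unique (a₂ := (A m) (x' m - x m) + (g m (x' m) - f m (x m))) (by
    have hterm : (fun k => G (m + 1) k (g k (x' k) - f k (x k))) = fun k =>
        (A m : X →L[ℝ] X) (G m k (g k (x' k) - f k (x k))) +
          if k = m then g m (x' m) - f m (x m) else 0 := by
      funext k
      rw [hrec]
      by_cases hk : k = m
      · subst hk; simp
      · simp [hk]
    rw [hterm]
    exact h1)
  rw [hx m, map_sub] at h2
  rw [sub_eq_iff_eq_add.1 h2]
  abel

theorem GreenRel.norm_sub_le (hG : GreenBound G ω ℓ b C) (hω : ∀ k, 0 ≤ ω k) (hb : 0 ≤ b)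
    (hM : 0 ≤ M) (hf : IsBddLip ω M c f) (hg : IsBddLip ω M c g) {x x' : ℕ → X}
    (h : GreenRel G f g x x') (m : ℕ) : ‖x' m - x m‖ ≤ C * (2 * M) := by
  have := hG.norm_le hω hb (T := 2 * M) (by positivity) (n := m) (fun k => ?_) (h m)
  · simpa using this
  · have h0 := hω k
    have h1 := one_le_expWeight ℓ hb k m
    calc _ ≤ 2 * M * ω k := hf.norm_sub_le hg k _ _
      _ = ω k * (2 * M) * 1 := by ring
      _ ≤ _ := by gcongr

theorem IsBddLip.exists_greenRel [CompleteSpace X] (hG : GreenBound G ω ℓ b C)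
    (hω : ∀ k, 0 ≤ ω k) (hb : 0 ≤ b) (hM : 0 ≤ M) (hc : 0 ≤ c) (hcC : C * c ≤ 1 / 2)
    (hf : IsBddLip ω M c f) (hg : IsBddLip ω M c g) (x : ℕ → X) :
    ∃ x', GreenRel G f g x x' := by
  let q : (ℕ → X) → ℕ → X := fun w k => g k (x k + w k) - f k (x k)
  have hq : ∀ w m k, ‖q w k‖ ≤ ω k * (2 * M) * expWeight ℓ b k m := fun w m k => by
    have h0 := hω k
    have h1 := one_le_expWeight ℓ hb k m
    calc _ ≤ 2 * M * ω k := hf.norm_sub_le hg k _ _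
      _ = ω k * (2 * M) * 1 := by ring
      _ ≤ _ := by gcongr
  have hs : ∀ w m, Summable fun k => G m k (q w k) := fun w m =>
    hG.summable_apply hω hb (by positivity) (hq w m) m
  let T : BoundedContinuousFunction ℕ X → BoundedContinuousFunction ℕ X := fun w =>
    BoundedContinuousFunction.ofNormedAddCommGroupDiscrete (fun m => ∑' k, G m k (q w k))
      (C * (2 * M)) fun m => by
        simpa using hG.norm_le hω hb (by positivity) (hq w m) (hs w m).hasSum
  have hT : ContractingWith (1 / 2) T := by
    refine ⟨by norm_num, LipschitzWith.of_dist_le_mul fun w w' => ?_⟩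
    rw [BoundedContinuousFunction.dist_le (by positivity)]
    intro m
    have hsub := (hs w m).hasSum.sub (hs w' m).hasSum
    simp only [← map_sub] at hsub
    have := hG.norm_le hω hb (T := c * dist w w') (by positivity) (n := m) (fun k => ?_) hsub
    · rw [dist_eq_norm]
      refine this.trans ?_
      rw [expWeight_self, mul_one, ← mul_assoc]
      gcongr
      simpa using hcC
    · have h0 := hω k
      have h1 := one_le_expWeight ℓ hb k m
      have h2 : ‖w k - w' k‖ ≤ dist w w' := by
        rw [← dist_eq_norm]; exact BoundedContinuousFunction.dist_coe_le_dist k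
      calc ‖q w k - q w' k‖ = ‖g k (x k + w k) - g k (x k + w' k)‖ := by simp [q]
        _ ≤ c * ω k * ‖w k - w' k‖ := by
            simpa using (hg k).2 (x k + w k) (x k + w' k)
        _ ≤ c * ω k * dist w w' := by gcongr
        _ = ω k * (c * dist w w') * 1 := by ring
        _ ≤ _ := by gcongr
  have hfix : T (hT.fixedPoint T) = hT.fixedPoint T := hT.fixedPoint_isFixedPt
  set w := hT.fixedPoint T
  refine ⟨fun k => x k + w k, fun m => ?_⟩
  have hwm : ∑' k, G m k (q w k) = w m := congrArg (fun v => v m) hfix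
  have := (hs w m).hasSum
  rw [hwm] at this
  simpa [q] using this

theorem IsBddLip.norm_sub_le_rpow {Y : Type*} [NormedAddCommGroup Y] {g : ℕ → Y → Y}
    (hω : ∀ k, 0 ≤ ω k) (hM : 0 ≤ M) (hc : 0 ≤ c)
    (hg : IsBddLip ω M c g) {ρ : ℝ} (hρ : 0 < ρ) (hρ1 : ρ ≤ 1) (k : ℕ) (x y x' y' : Y) :
    ‖g k x' - g k y'‖ ≤
      ω k * (c * ‖(x' - x) - (y' - y)‖ + (2 * M + c) * ‖x - y‖ ^ ρ) := by
  have h0 := hω k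
  have hpos : 0 ≤ ‖x - y‖ ^ ρ := by positivity
  rcases le_total ‖x - y‖ 1 with h | h
  · have h1 : ‖x - y‖ ≤ ‖x - y‖ ^ ρ := by
      simpa using Real.rpow_le_rpow_of_exponent_ge' (norm_nonneg _) h hρ.le hρ1
    have h2 : ‖x' - y'‖ ≤ ‖(x' - x) - (y' - y)‖ + ‖x - y‖ ^ ρ := by
      calc ‖x' - y'‖ = ‖((x' - x) - (y' - y)) + (x - y)‖ := by congr 1; abel
        _ ≤ _ := (norm_add_le _ _).trans (by gcongr)
    calc _ ≤ c * ω k * ‖x' - y'‖ := (hg k).2 _ _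
      _ ≤ c * ω k * (‖(x' - x) - (y' - y)‖ + ‖x - y‖ ^ ρ) := by gcongr
      _ = ω k * (c * ‖(x' - x) - (y' - y)‖ + (0 + c) * ‖x - y‖ ^ ρ) := by ring
      _ ≤ _ := by gcongr; positivity
  · have h1 : 1 ≤ ‖x - y‖ ^ ρ := Real.one_le_rpow h hρ.le
    calc _ ≤ 2 * M * ω k := hg.norm_sub_le hg k _ _
      _ = ω k * (0 + (2 * M + 0) * 1) := by ring
      _ ≤ _ := by gcongr; positivity

theorem GreenRel.norm_sub_sub_le (hG : GreenBound G ω ℓ b C) (hω : ∀ k, 0 ≤ ω k) (hb : 0 ≤ b)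
    (hM : 0 ≤ M) (hc : 0 ≤ c) (hcC : C * c ≤ 1 / 2)
    (hf : IsBddLip ω M c f) (hg : IsBddLip ω M c g) {ρ : ℝ} (hρ : 0 < ρ) (hρ1 : ρ ≤ 1)
    {x x' y y' : ℕ → X} (hx : GreenRel G f g x x') (hy : GreenRel G f g y y') {n : ℕ} {E : ℝ}
    (hE : 0 ≤ E) (hxy : ∀ k, ‖x k - y k‖ ^ ρ ≤ E * expWeight ℓ b k n) :
    ‖(x' n - x n) - (y' n - y n)‖ ≤ 2 * (C * (2 * (2 * M + c) * E)) := by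
  have hC := hG.nonneg hω
  have key := le_two_mul_of_self_improving (s := Set.univ)
    (e := fun m => ‖(x' m - x m) - (y' m - y m)‖) (S := fun m => expWeight ℓ b m n)
    (a := C * (2 * (2 * M + c) * E)) (B := C * (2 * M) + C * (2 * M))
    (fun m _ => expWeight_pos ℓ b m n) (fun m _ => norm_nonneg _) (fun m _ => ?_) ?_
  · simpa using key n trivial
  · calc _ ≤ C * (2 * M) + C * (2 * M) := (_root_.norm_sub_le _ _).trans
          (add_le_add (hx.norm_sub_le hG hω hb hM hf hg m) (hy.norm_sub_le hG hω hb hM hf hg m))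
      _ ≤ _ := le_mul_of_one_le_right (by positivity) (one_le_expWeight ℓ hb m n)
  · intro t ht h m _
    have hsub := (hx m).sub (hy m)
    simp only [← map_sub] at hsub
    have := hG.norm_le hω hb (T := c * t + 2 * (2 * M + c) * E) (by positivity) (n := n)
      (fun k => ?_) hsub
    · refine this.trans ?_
      have hw := (expWeight_pos ℓ b m n).le
      refine mul_le_mul_of_nonneg_right ?_ hw
      nlinarith
    · have h0 := hω k
      have h1 := hg.norm_sub_le_rpow hω hM hc hρ hρ1 k (x k) (y k) (x' k) (y' k)
      have h2 := hf.norm_sub_le_rpow hω hM hc hρ hρ1 k (x k) (y k) (x k) (y k)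
      simp only [sub_self, norm_zero, mul_zero, zero_add] at h2
      have h3 := h k trivial
      have h4 := hxy k
      calc _ = ‖(g k (x' k) - g k (y' k)) - (f k (x k) - f k (y k))‖ := by congr 1; abel
        _ ≤ ω k * (c * ‖(x' k - x k) - (y' k - y k)‖ + (2 * M + c) * ‖x k - y k‖ ^ ρ)
            + ω k * ((2 * M + c) * ‖x k - y k‖ ^ ρ) :=
          (_root_.norm_sub_le _ _).trans (add_le_add h1 h2)
        _ ≤ ω k * (c * (t * expWeight ℓ b k n) + (2 * M + c) * (E * expWeight ℓ b k n))
            + ω k * ((2 * M + c) * (E * expWeight ℓ b k n)) := by gcongr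
        _ = _ := by ring

end Green

section Conjugacy

theorem exists_isOrbit {A : ℕ → X ≃L[ℝ] X} {f : ℕ → X → X}
    (hf : ∀ k, Function.Bijective fun x => A k x + f k x) (n : ℕ) (p : X) :
    ∃ x, IsOrbit A f x ∧ x n = p := by
  let F : ℕ → X ≃ X := fun k => Equiv.ofBijective _ (hf k)
  let Ψ : ℕ → X ≃ X := fun k => Nat.rec (Equiv.refl X) (fun j e => e.trans (F j)) k
  exact ⟨fun k => Ψ k ((Ψ n).symm p), fun k => rfl, (Ψ n).apply_symm_apply p⟩

/-- Orbits of `A + f` diverge, in both time directions, at most at the rate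
`expWeight ℓ s`. -/
def OrbitGrowth (A : ℕ → X ≃L[ℝ] X) (f : ℕ → X → X) (ℓ : ℕ → ℝ) (s : ℝ) (Λ : ℕ → ℝ) : Prop :=
  ∀ x y, IsOrbit A f x → IsOrbit A f y → ∀ n k,
    ‖x k - y k‖ ≤ Λ n * ‖x n - y n‖ * expWeight ℓ s k n

/-- `p'` is the position at time `n` of the orbit of `A + g` in Green relation with the orbit
of `A + f` through `p` at time `n`. -/
def ConjRel (A : ℕ → X ≃L[ℝ] X) (G : ℕ → ℕ → X →L[ℝ] X) (f g : ℕ → X → X) (n : ℕ)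
    (p p' : X) : Prop :=
  ∃ x x', IsOrbit A f x ∧ IsOrbit A g x' ∧ GreenRel G f g x x' ∧ x n = p ∧ x' n = p'

variable {A : ℕ → X ≃L[ℝ] X} {G : ℕ → ℕ → X →L[ℝ] X} {ω ℓ Λ : ℕ → ℝ} {b C M c s ρ : ℝ}
  {f g : ℕ → X → X}

theorem ConjRel.symm {n : ℕ} {p p' : X} (h : ConjRel A G f g n p p') :
    ConjRel A G g f n p' p := by
  obtain ⟨x, x', hx, hx', hxx, hp, hp'⟩ := h
  exact ⟨x', x, hx', hx, hxx.symm, hp', hp⟩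

theorem ConjRel.succ {n : ℕ} {p p' : X} (h : ConjRel A G f g n p p') :
    ConjRel A G f g (n + 1) (A n p + f n p) (A n p' + g n p') := by
  obtain ⟨x, x', hx, hx', hxx, rfl, rfl⟩ := h
  exact ⟨x, x', hx, hx', hxx, hx n, hx' n⟩

theorem ConjRel.norm_sub_le (hG : GreenBound G ω ℓ b C) (hω : ∀ k, 0 ≤ ω k) (hb : 0 ≤ b)
    (hM : 0 ≤ M) (hf : IsBddLip ω M c f) (hg : IsBddLip ω M c g) {n : ℕ} {p p' : X}
    (h : ConjRel A G f g n p p') : ‖p' - p‖ ≤ C * (2 * M) := by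
  obtain ⟨x, x', hx, hx', hxx, rfl, rfl⟩ := h
  exact hxx.norm_sub_le hG hω hb hM hf hg n

theorem ConjRel.norm_sub_sub_le (hG : GreenBound G ω ℓ b C) (hω : ∀ k, 0 ≤ ω k) (hb : 0 ≤ b)
    (hM : 0 ≤ M) (hc : 0 ≤ c) (hcC : C * c ≤ 1 / 2)
    (hf : IsBddLip ω M c f) (hg : IsBddLip ω M c g) (hρ : 0 < ρ) (hρ1 : ρ ≤ 1)
    (hρs : ρ * s = b) (hΛ : ∀ n, 0 ≤ Λ n) (hgrow : OrbitGrowth A f ℓ s Λ) {n : ℕ}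
    {p p' q q' : X} (hp : ConjRel A G f g n p p') (hq : ConjRel A G f g n q q') :
    ‖(p' - p) - (q' - q)‖ ≤ 4 * C * (2 * M + c) * (Λ n * ‖p - q‖) ^ ρ := by
  obtain ⟨x, x', hx, hx', hxx, rfl, rfl⟩ := hp
  obtain ⟨y, y', hy, hy', hyy, rfl, rfl⟩ := hq
  have h0 : 0 ≤ Λ n * ‖x n - y n‖ := mul_nonneg (hΛ n) (norm_nonneg _)
  have := hxx.norm_sub_sub_le hG hω hb hM hc hcC hf hg hρ hρ1 hyy (n := n)
    (E := (Λ n * ‖x n - y n‖) ^ ρ) (by positivity) fun k => by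
      calc ‖x k - y k‖ ^ ρ ≤ (Λ n * ‖x n - y n‖ * expWeight ℓ s k n) ^ ρ :=
            Real.rpow_le_rpow (norm_nonneg _) (hgrow x y hx hy n k) hρ.le
        _ = _ := by
            rw [Real.mul_rpow h0 (expWeight_pos ℓ s k n).le, expWeight, expWeight,
              ← Real.exp_mul, ← hρs]
            ring_nf
  linarith

theorem ConjRel.right_unique (hG : GreenBound G ω ℓ b C) (hω : ∀ k, 0 ≤ ω k) (hb : 0 ≤ b)
    (hM : 0 ≤ M) (hc : 0 ≤ c) (hcC : C * c ≤ 1 / 2)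
    (hf : IsBddLip ω M c f) (hg : IsBddLip ω M c g) (hρ : 0 < ρ) (hρ1 : ρ ≤ 1)
    (hρs : ρ * s = b) (hΛ : ∀ n, 0 ≤ Λ n) (hgrow : OrbitGrowth A f ℓ s Λ) {n : ℕ}
    {p p' p'' : X} (hp : ConjRel A G f g n p p') (hq : ConjRel A G f g n p p'') : p' = p'' := by
  have := hp.norm_sub_sub_le hG hω hb hM hc hcC hf hg hρ hρ1 hρs hΛ hgrow hq
  simpa [Real.zero_rpow hρ.ne', sub_eq_zero] using this

theorem exists_conjRel [CompleteSpace X]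
    (hrec : ∀ m k, G (m + 1) k = (A m : X →L[ℝ] X).comp (G m k) + if k = m then 1 else 0)
    (hG : GreenBound G ω ℓ b C) (hω : ∀ k, 0 ≤ ω k) (hb : 0 ≤ b)
    (hM : 0 ≤ M) (hc : 0 ≤ c) (hcC : C * c ≤ 1 / 2)
    (hf : IsBddLip ω M c f) (hg : IsBddLip ω M c g)
    (hbij : ∀ k, Function.Bijective fun x => A k x + f k x) (n : ℕ) (p : X) :
    ∃ p', ConjRel A G f g n p p' := by
  obtain ⟨x, hx, hxn⟩ := exists_isOrbit hbij n p
  obtain ⟨x', hx'⟩ := hf.exists_greenRel hG hω hb hM hc hcC hg x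
  exact ⟨x' n, x, x', hx, hx'.isOrbit hrec hx, hx', hxn, rfl⟩

theorem continuous_of_norm_sub_sub_le {Y : Type*} [NormedAddCommGroup Y]
    {H : Y → Y} {K : ℝ} (hρ : 0 < ρ)
    (h : ∀ x y, ‖(H x - x) - (H y - y)‖ ≤ K * ‖x - y‖ ^ ρ) : Continuous H := by
  refine continuous_iff_continuousAt.2 fun y => ?_
  have hlim : Tendsto (fun x => K * ‖x - y‖ ^ ρ) (𝓝 y) (𝓝 0) := by
    have : ContinuousAt (fun x => K * ‖x - y‖ ^ ρ) y :=
      continuousAt_const.mul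
        ((continuousAt_id.sub continuousAt_const).norm.rpow_const (Or.inr hρ.le))
    simpa [ContinuousAt, Real.zero_rpow hρ.ne'] using this
  have h1 : Tendsto (fun x => H x - x) (𝓝 y) (𝓝 (H y - y)) :=
    tendsto_iff_norm_sub_tendsto_zero.2
      (squeeze_zero (fun _ => norm_nonneg _) (fun x => h x y) hlim)
  simpa [ContinuousAt] using h1.add tendsto_id

theorem exists_conjugating_homeomorph [CompleteSpace X]
    (hrec : ∀ m k, G (m + 1) k = (A m : X →L[ℝ] X).comp (G m k) + if k = m then 1 else 0)
    (hG : GreenBound G ω ℓ b C) (hω : ∀ k, 0 ≤ ω k) (hb : 0 ≤ b)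
    (hM : 0 ≤ M) (hc : 0 ≤ c) (hcC : C * c ≤ 1 / 2)
    (hf : IsBddLip ω M c f) (hg : IsBddLip ω M c g) (hρ : 0 < ρ) (hρ1 : ρ ≤ 1)
    (hρs : ρ * s = b) (hΛ : ∀ n, 0 ≤ Λ n)
    (hfbij : ∀ k, Function.Bijective fun x => A k x + f k x)
    (hgbij : ∀ k, Function.Bijective fun x => A k x + g k x)
    (hfgrow : OrbitGrowth A f ℓ s Λ) (hggrow : OrbitGrowth A g ℓ s Λ) :
    ∃ h : ℕ → X ≃ₜ X,
      (∀ n x, h (n + 1) (A n x + f n x) = A n (h n x) + g n (h n x)) ∧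
      (∀ n x, ‖h n x - x‖ ≤ C * (2 * M) ∧ ‖(h n).symm x - x‖ ≤ C * (2 * M)) ∧
      ∀ n x y,
        ‖(h n x - x) - (h n y - y)‖ ≤ 4 * C * (2 * M + c) * (Λ n * ‖x - y‖) ^ ρ ∧
        ‖((h n).symm x - x) - ((h n).symm y - y)‖ ≤
          4 * C * (2 * M + c) * (Λ n * ‖x - y‖) ^ ρ := by
  choose H hH using exists_conjRel hrec hG hω hb hM hc hcC hf hg hfbij
  choose H' hH' using exists_conjRel hrec hG hω hb hM hc hcC hg hf hgbij
  have hol := fun n x y =>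
    (hH n x).norm_sub_sub_le hG hω hb hM hc hcC hf hg hρ hρ1 hρs hΛ hfgrow (hH n y)
  have hol' := fun n x y =>
    (hH' n x).norm_sub_sub_le hG hω hb hM hc hcC hg hf hρ hρ1 hρs hΛ hggrow (hH' n y)
  have hmul : ∀ n (x y : X), 4 * C * (2 * M + c) * (Λ n * ‖x - y‖) ^ ρ =
      4 * C * (2 * M + c) * Λ n ^ ρ * ‖x - y‖ ^ ρ := fun n x y => by
    rw [Real.mul_rpow (hΛ n) (norm_nonneg _), ← mul_assoc]
  refine ⟨fun n =>
    { toFun := H n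
      invFun := H' n
      left_inv := fun x => (hH' n (H n x)).right_unique hG hω hb hM hc hcC hg hf hρ hρ1 hρs hΛ
        hggrow (hH n x).symm
      right_inv := fun x => (hH n (H' n x)).right_unique hG hω hb hM hc hcC hf hg hρ hρ1 hρs hΛ
        hfgrow (hH' n x).symm
      continuous_toFun := continuous_of_norm_sub_sub_le hρ
        fun x y => (hol n x y).trans_eq (hmul n x y)
      continuous_invFun := continuous_of_norm_sub_sub_le hρ
        fun x y => (hol' n x y).trans_eq (hmul n x y) }, fun n x => ?_, fun n x => ⟨?_, ?_⟩,
    fun n x y => ⟨hol n x y, hol' n x y⟩⟩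
  · exact (hH (n + 1) _).right_unique hG hω hb hM hc hcC hf hg hρ hρ1 hρs hΛ hfgrow (hH n x).succ
  · exact (hH n x).norm_sub_le hG hω hb hM hf hg
  · exact (hH' n x).norm_sub_le hG hω hb hM hg hf

end Conjugacy

section LinearEvolution

theorem sub_mul_exp_le (s t : ℝ) : (t - s) * Real.exp s ≤ Real.exp t - Real.exp s := by
  have h := Real.add_one_le_exp (t - s)
  have := mul_le_mul_of_nonneg_right h (Real.exp_pos s).le
  rw [← Real.exp_add, sub_add_cancel] at this
  linarith

theorem bijective_add_of_lipschitz [CompleteSpace X] {A : X ≃L[ℝ] X} {f : X → X} {K c : ℝ}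
    (hK : 0 ≤ K) (hA : ∀ z, ‖A.symm z‖ ≤ K * ‖z‖) (hf : ∀ x y, ‖f x - f y‖ ≤ c * ‖x - y‖)
    (hKc : K * c ≤ 1 / 2) : Function.Bijective fun x => A x + f x := by
  have hcontr : ∀ z, ContractingWith (1 / 2) fun x => A.symm (z - f x) := fun z => by
    refine ⟨by norm_num, LipschitzWith.of_dist_le_mul fun x y => ?_⟩
    rw [dist_eq_norm, dist_eq_norm, ← map_sub, sub_sub_sub_cancel_left]
    calc ‖A.symm (f y - f x)‖ ≤ K * ‖f y - f x‖ := hA _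
      _ ≤ K * (c * ‖y - x‖) := by gcongr; exact hf y x
      _ = K * c * ‖x - y‖ := by rw [norm_sub_rev, mul_assoc]
      _ ≤ 1 / 2 * ‖x - y‖ := by gcongr
      _ = _ := by norm_num
  have hiff : ∀ x z, A x + f x = z ↔ Function.IsFixedPt (fun x => A.symm (z - f x)) x :=
    fun x z => by
      rw [Function.IsFixedPt, ContinuousLinearEquiv.symm_apply_eq, sub_eq_iff_eq_add, eq_comm]
  refine (Function.bijective_iff_existsUnique _).2 fun z => ?_
  refine ⟨(hcontr z).fixedPoint _, (hiff _ z).2 (hcontr z).fixedPoint_isFixedPt, fun y hy => ?_⟩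
  exact (hcontr z).fixedPoint_unique ((hiff y z).1 hy)

/-- The transition operator of `A` from time `k` to time `m`. -/
def transition (A : ℕ → X ≃L[ℝ] X) (m k : ℕ) : X →L[ℝ] X :=
  ((evolFwdE A 0 k).symm.trans (evolFwdE A 0 m) : X ≃L[ℝ] X)

theorem transition_apply (A : ℕ → X ≃L[ℝ] X) (m k : ℕ) (x : X) :
    transition A m k x = evolFwdE A 0 m ((evolFwdE A 0 k).symm x) := rfl

@[simp]
theorem transition_self (A : ℕ → X ≃L[ℝ] X) (m : ℕ) : transition A m m = 1 := by
  ext x; simp [transition_apply]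

theorem transition_succ (A : ℕ → X ≃L[ℝ] X) (m k : ℕ) :
    transition A (m + 1) k = (A m : X →L[ℝ] X).comp (transition A m k) := by
  ext x; simp [transition_apply, evolFwdE]

theorem transition_self_succ (A : ℕ → X ≃L[ℝ] X) (m : ℕ) :
    transition A m (m + 1) = (A m).symm := by
  ext x; simp [transition_apply, evolFwdE]

theorem evolE_succ_succ (A : ℕ → X ≃L[ℝ] X) (m k : ℕ) :
    evolE A (m + 1) (k + 1) = transition (fun n => A (n + 1)) m k := by
  have key : ∀ k j (x : X), evolFwdE (fun n => A (n + 1)) 0 (k + j) x =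
      evolFwdE A (k + 1) j (evolFwdE (fun n => A (n + 1)) 0 k x) := by
    intro k j
    induction j with
    | zero => intro x; rfl
    | succ j ih =>
      intro x
      rw [← add_assoc]
      simp only [evolFwdE, ContinuousLinearEquiv.trans_apply, ih, zero_add]
      rw [add_right_comm]
  ext x
  rw [transition_apply, evolE, evolEquiv]
  split_ifs with h
  · have h' : k ≤ m := by omega
    have := key k (m - k) ((evolFwdE (fun n => A (n + 1)) 0 k).symm x)
    rw [Nat.add_sub_cancel' h', ContinuousLinearEquiv.apply_symm_apply] at this
    rw [this, Nat.add_sub_add_right]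
    rfl
  · have h' : m ≤ k := by omega
    have := key m (k - m) ((evolFwdE (fun n => A (n + 1)) 0 k).symm x)
    rw [Nat.add_sub_cancel' h', ContinuousLinearEquiv.apply_symm_apply] at this
    rw [Nat.add_sub_add_right]
    exact (ContinuousLinearEquiv.symm_apply_eq _).2 this

variable {A : ℕ → X ≃L[ℝ] X} {f : ℕ → X → X} {ω ℓ : ℕ → ℝ} {M c N s ε L : ℝ}

theorem transition_sub_eq_sum {d q : ℕ → X} (hd : ∀ k, d (k + 1) = A k (d k) + q k) (l : ℕ)
    {n m : ℕ} (hnm : n ≤ m) :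
    transition A l m (d m) - transition A l n (d n) =
      ∑ j ∈ Finset.Ico n m, transition A l (j + 1) (q j) := by
  induction m, hnm using Nat.le_induction with
  | base => simp
  | succ m hm ih =>
    rw [Finset.sum_Ico_succ_top hm, ← ih, hd]
    simp [transition_apply, evolFwdE]
    abel

/-- Exponential bound on the evolution of `A`, in both time directions, with nonuniformity `ε`. -/
def TransitionBound (A : ℕ → X ≃L[ℝ] X) (ℓ : ℕ → ℝ) (N s ε : ℝ) : Prop :=
  ∀ m k, ‖transition A m k‖ ≤ N * Real.exp (s * |ℓ m - ℓ k|) * Real.exp (ε * ℓ k)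

/-- The size `(ℓ (k + 1) - ℓ k) * e ^ (-ε ℓ k)` of admissible perturbations. -/
def pertSize (ℓ : ℕ → ℝ) (ε : ℝ) (k : ℕ) : ℝ := (ℓ (k + 1) - ℓ k) * Real.exp (-(ε * ℓ k))

theorem pertSize_nonneg (hℓ : Monotone ℓ) (k : ℕ) : 0 ≤ pertSize ℓ ε k :=
  mul_nonneg (sub_nonneg.2 (hℓ k.le_succ)) (Real.exp_pos _).le

theorem sum_Ico_growth_le (hℓ : Monotone ℓ) (hL : ∀ k, ℓ (k + 1) - ℓ k ≤ L) (hs : 0 ≤ s)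
    (hε : 0 ≤ ε) {n m : ℕ} (hnm : n ≤ m) :
    ∑ j ∈ Finset.Ico n m, Real.exp (s * |ℓ m - ℓ (j + 1)|) * Real.exp (ε * ℓ (j + 1)) *
      pertSize ℓ ε j * expWeight ℓ (s + 1) j n ≤
      Real.exp ((s + ε + 1) * L) * expWeight ℓ (s + 1) m n := by
  calc _ ≤ ∑ j ∈ Finset.Ico n m, Real.exp ((s + ε + 1) * L) * Real.exp (s * (ℓ m - ℓ n)) *
        (Real.exp (ℓ (j + 1) - ℓ n) - Real.exp (ℓ j - ℓ n)) := by
        refine Finset.sum_le_sum fun j hj => ?_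
        obtain ⟨h1, h2⟩ := Finset.mem_Ico.1 hj
        have e1 : 0 ≤ ℓ j - ℓ n := sub_nonneg.2 (hℓ h1)
        have e2 : 0 ≤ ℓ m - ℓ (j + 1) := sub_nonneg.2 (hℓ h2)
        have e3 : 0 ≤ ℓ (j + 1) - ℓ j := sub_nonneg.2 (hℓ j.le_succ)
        have e4 := hL j
        have hstep := sub_mul_exp_le (ℓ j - ℓ n) (ℓ (j + 1) - ℓ n)
        rw [expWeight, pertSize, abs_of_nonneg e1, abs_of_nonneg e2]
        calc _ = Real.exp (s * (ℓ m - ℓ (j + 1)) + ε * ℓ (j + 1) + -(ε * ℓ j)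
              + s * (ℓ j - ℓ n)) *
              ((ℓ (j + 1) - ℓ n - (ℓ j - ℓ n)) * Real.exp (ℓ j - ℓ n)) := by
              rw [show (s + 1) * (ℓ j - ℓ n) = s * (ℓ j - ℓ n) + (ℓ j - ℓ n) by ring]
              simp only [Real.exp_add]
              ring
          _ ≤ Real.exp ((s + ε + 1) * L + s * (ℓ m - ℓ n)) *
              (Real.exp (ℓ (j + 1) - ℓ n) - Real.exp (ℓ j - ℓ n)) := by
              refine mul_le_mul (Real.exp_le_exp.2 ?_) hstep ?_ (Real.exp_pos _).le
              · nlinarith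
              · rw [sub_sub_sub_cancel_right]; positivity
          _ = _ := by rw [Real.exp_add]
    _ = Real.exp ((s + ε + 1) * L) * Real.exp (s * (ℓ m - ℓ n)) *
        (Real.exp (ℓ m - ℓ n) - Real.exp (ℓ n - ℓ n)) := by
        rw [← Finset.mul_sum, Finset.sum_Ico_sub (fun j => Real.exp (ℓ j - ℓ n)) hnm]
    _ ≤ Real.exp ((s + ε + 1) * L) * Real.exp (s * (ℓ m - ℓ n)) * Real.exp (ℓ m - ℓ n) := by
        gcongr
        linarith [Real.exp_pos (ℓ n - ℓ n)]
    _ = _ := by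
        rw [expWeight, abs_of_nonneg (sub_nonneg.2 (hℓ hnm)), mul_assoc, ← Real.exp_add]
        ring_nf

theorem sum_Ico_decay_le (hℓ : Monotone ℓ) (hL : ∀ k, ℓ (k + 1) - ℓ k ≤ L) (hs : 0 ≤ s)
    (hε : 0 ≤ ε) {n m : ℕ} (hmn : m ≤ n) :
    ∑ j ∈ Finset.Ico m n, Real.exp (s * |ℓ m - ℓ (j + 1)|) * Real.exp (ε * ℓ (j + 1)) *
      pertSize ℓ ε j * expWeight ℓ (s + 1) j n ≤
      Real.exp ((s + ε + 1) * L) * expWeight ℓ (s + 1) m n := by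
  calc _ ≤ ∑ j ∈ Finset.Ico m n, Real.exp ((s + ε + 1) * L) * Real.exp (s * (ℓ n - ℓ m)) *
        (-Real.exp (ℓ n - ℓ (j + 1)) - -Real.exp (ℓ n - ℓ j)) := by
        refine Finset.sum_le_sum fun j hj => ?_
        obtain ⟨h1, h2⟩ := Finset.mem_Ico.1 hj
        have e1 : ℓ j - ℓ n ≤ 0 := sub_nonpos.2 (hℓ h2.le)
        have e2 : ℓ m - ℓ (j + 1) ≤ 0 := sub_nonpos.2 (hℓ (h1.trans j.le_succ))
        have e3 : 0 ≤ ℓ (j + 1) - ℓ j := sub_nonneg.2 (hℓ j.le_succ)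
        have e4 := hL j
        have hstep := sub_mul_exp_le (ℓ n - ℓ (j + 1)) (ℓ n - ℓ j)
        rw [expWeight, pertSize, abs_of_nonpos e1, abs_of_nonpos e2]
        calc _ = Real.exp (s * -(ℓ m - ℓ (j + 1)) + ε * ℓ (j + 1) + -(ε * ℓ j)
              + s * -(ℓ j - ℓ n) + (ℓ (j + 1) - ℓ j)) *
              ((ℓ n - ℓ j - (ℓ n - ℓ (j + 1))) * Real.exp (ℓ n - ℓ (j + 1))) := by
              rw [show (s + 1) * -(ℓ j - ℓ n) =
                s * -(ℓ j - ℓ n) + (ℓ (j + 1) - ℓ j) + (ℓ n - ℓ (j + 1)) by ring]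
              simp only [Real.exp_add]
              ring
          _ ≤ Real.exp ((s + ε + 1) * L + s * (ℓ n - ℓ m)) *
              (Real.exp (ℓ n - ℓ j) - Real.exp (ℓ n - ℓ (j + 1))) := by
              refine mul_le_mul (Real.exp_le_exp.2 ?_) hstep ?_ (Real.exp_pos _).le
              · nlinarith
              · rw [sub_sub_sub_cancel_left]; positivity
          _ = _ := by rw [Real.exp_add]; ring
    _ = Real.exp ((s + ε + 1) * L) * Real.exp (s * (ℓ n - ℓ m)) *
        (-Real.exp (ℓ n - ℓ n) - -Real.exp (ℓ n - ℓ m)) := by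
        rw [← Finset.mul_sum, Finset.sum_Ico_sub (fun j => -Real.exp (ℓ n - ℓ j)) hmn]
    _ ≤ Real.exp ((s + ε + 1) * L) * Real.exp (s * (ℓ n - ℓ m)) * Real.exp (ℓ n - ℓ m) := by
        gcongr
        linarith [Real.exp_pos (ℓ n - ℓ n)]
    _ = _ := by
        rw [expWeight, abs_of_nonpos (sub_nonpos.2 (hℓ hmn)), mul_assoc, ← Real.exp_add]
        ring_nf

theorem TransitionBound.norm_sum_le (hA : TransitionBound A ℓ N s ε) (hN : 0 ≤ N)
    (hℓ : Monotone ℓ) (hc : 0 ≤ c) (hf : IsBddLip (pertSize ℓ ε) M c f) {x y : ℕ → X} {t : ℝ}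
    (m n : ℕ) (I : Finset ℕ)
    (ht : ∀ j ∈ I, ‖x j - y j‖ ≤ t * expWeight ℓ (s + 1) j n) :
    ‖∑ j ∈ I, transition A m (j + 1) (f j (x j) - f j (y j))‖ ≤
      N * c * t * ∑ j ∈ I, Real.exp (s * |ℓ m - ℓ (j + 1)|) * Real.exp (ε * ℓ (j + 1)) *
        pertSize ℓ ε j * expWeight ℓ (s + 1) j n := by
  rw [Finset.mul_sum]
  refine norm_sum_le_of_le _ fun j hj => ?_
  have h0 := pertSize_nonneg (ε := ε) hℓ j
  have h1 := (expWeight_pos ℓ (s + 1) j n).le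
  calc _ ≤ ‖transition A m (j + 1)‖ * ‖f j (x j) - f j (y j)‖ := ContinuousLinearMap.le_opNorm _ _
    _ ≤ (N * Real.exp (s * |ℓ m - ℓ (j + 1)|) * Real.exp (ε * ℓ (j + 1))) *
        (c * pertSize ℓ ε j * (t * expWeight ℓ (s + 1) j n)) := by
        gcongr
        · exact hA m (j + 1)
        · exact ((hf j).2 _ _).trans (by gcongr; exact ht j hj)
    _ = _ := by ring

theorem TransitionBound.orbitGrowth (hA : TransitionBound A ℓ N s ε) (hN : 0 ≤ N)
    (hℓ : Monotone ℓ) (hL : ∀ k, ℓ (k + 1) - ℓ k ≤ L) (hs : 0 ≤ s) (hε : 0 ≤ ε) (hc : 0 ≤ c)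
    (hcN : N * c * Real.exp ((s + ε + 1) * L) ≤ 1 / 2)
    (hf : IsBddLip (pertSize ℓ ε) M c f) :
    OrbitGrowth A f ℓ (s + 1) fun n => 2 * N * Real.exp (ε * ℓ n) := by
  intro x y hx hy n k
  have hd : ∀ j, x (j + 1) - y (j + 1) =
      A j (x j - y j) + (f j (x j) - f j (y j)) := fun j => by
    rw [hx j, hy j, map_sub]; abel
  have hlin : ∀ m, ‖transition A m n (x n - y n)‖ ≤
      N * Real.exp (ε * ℓ n) * ‖x n - y n‖ * expWeight ℓ (s + 1) m n := fun m => by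
    calc _ ≤ (N * Real.exp (s * |ℓ m - ℓ n|) * Real.exp (ε * ℓ n)) * ‖x n - y n‖ :=
          (transition A m n).le_of_opNorm_le (hA m n) _
      _ = N * Real.exp (ε * ℓ n) * ‖x n - y n‖ * Real.exp (s * |ℓ m - ℓ n|) := by ring
      _ ≤ _ := by rw [expWeight]; gcongr; linarith
  set a := N * Real.exp (ε * ℓ n) * ‖x n - y n‖ with ha
  have hfin : ∃ B, ∀ j ∈ Set.Iic (n + k), ‖x j - y j‖ ≤ B * expWeight ℓ (s + 1) j n := by
    obtain ⟨B, hB⟩ := ((Set.finite_Iic (n + k)).image fun j => ‖x j - y j‖).bddAbove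
    refine ⟨B, fun j hj => ?_⟩
    have hj' : ‖x j - y j‖ ≤ B := hB ⟨j, hj, rfl⟩
    exact hj'.trans (le_mul_of_one_le_right ((norm_nonneg _).trans hj')
      (one_le_expWeight ℓ (by linarith) j n))
  obtain ⟨B, hB⟩ := hfin
  have := le_two_mul_of_self_improving (a := a) (fun j _ => expWeight_pos ℓ (s + 1) j n)
    (fun j _ => norm_nonneg _) hB (fun t ht h m hm => ?_) k (by simp)
  · rw [ha] at this; linarith
  have hsum : ∀ I : Finset ℕ, (∀ j ∈ I, j ≤ n + k) →
      (∑ j ∈ I, Real.exp (s * |ℓ m - ℓ (j + 1)|) * Real.exp (ε * ℓ (j + 1)) *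
        pertSize ℓ ε j * expWeight ℓ (s + 1) j n ≤
        Real.exp ((s + ε + 1) * L) * expWeight ℓ (s + 1) m n) →
      ‖∑ j ∈ I, transition A m (j + 1) (f j (x j) - f j (y j))‖ ≤
        t / 2 * expWeight ℓ (s + 1) m n := fun I hI hIle => by
    have hw := (expWeight_pos ℓ (s + 1) m n).le
    calc _ ≤ N * c * t * _ := hA.norm_sum_le hN hℓ hc hf m n I fun j hj => h j (hI j hj)
      _ ≤ N * c * t * (Real.exp ((s + ε + 1) * L) * expWeight ℓ (s + 1) m n) := by gcongr
      _ = (N * c * Real.exp ((s + ε + 1) * L)) * (t * expWeight ℓ (s + 1) m n) := by ring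
      _ ≤ 1 / 2 * (t * expWeight ℓ (s + 1) m n) := by gcongr
      _ = _ := by ring
  have hm' : m ≤ n + k := hm
  rw [add_mul]
  rcases le_total n m with hnm | hmn
  · have hvar := transition_sub_eq_sum (d := fun j => x j - y j) hd m hnm
    rw [transition_self, one_apply_eq_self, sub_eq_iff_eq_add'] at hvar
    rw [hvar]
    refine (norm_add_le _ _).trans (add_le_add (hlin m) (hsum _ (fun j hj => ?_)
      (sum_Ico_growth_le hℓ hL hs hε hnm)))
    exact (Finset.mem_Ico.1 hj).2.le.trans hm'
  · have hvar := transition_sub_eq_sum (d := fun j => x j - y j) hd m hmn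
    rw [transition_self, one_apply_eq_self, sub_eq_iff_eq_add, eq_comm,
      ← eq_sub_iff_add_eq'] at hvar
    rw [hvar]
    refine (norm_sub_le _ _).trans (add_le_add (hlin m) (hsum _ (fun j hj => ?_)
      (sum_Ico_decay_le hℓ hL hs hε hmn)))
    have := (Finset.mem_Ico.1 hj).2
    omega

theorem TransitionBound.bijective_add [CompleteSpace X] (hA : TransitionBound A ℓ N s ε)
    (hN : 0 ≤ N) (hℓ : Monotone ℓ) (hL : ∀ k, ℓ (k + 1) - ℓ k ≤ L) (hs : 0 ≤ s) (hε : 0 ≤ ε)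
    (hc : 0 ≤ c) (hcN : N * c * (L * Real.exp ((s + ε) * L)) ≤ 1 / 2)
    (hf : IsBddLip (pertSize ℓ ε) M c f) (k : ℕ) :
    Function.Bijective fun x => A k x + f k x := by
  have hstep : 0 ≤ ℓ (k + 1) - ℓ k := sub_nonneg.2 (hℓ k.le_succ)
  have hbound := hA k (k + 1)
  rw [transition_self_succ, abs_sub_comm, abs_of_nonneg hstep] at hbound
  refine bijective_add_of_lipschitz (A := A k) (by positivity)
    (fun z => ((A k).symm : X →L[ℝ] X).le_of_opNorm_le hbound z) (hf k).2 ?_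
  refine le_trans ?_ hcN
  have hLk := hL k
  have hexp : Real.exp (s * (ℓ (k + 1) - ℓ k)) * Real.exp (ε * ℓ (k + 1)) *
      Real.exp (-(ε * ℓ k)) ≤ Real.exp ((s + ε) * L) := by
    rw [← Real.exp_add, ← Real.exp_add]
    exact Real.exp_le_exp.2 (by nlinarith)
  calc _ = N * c * ((ℓ (k + 1) - ℓ k) * (Real.exp (s * (ℓ (k + 1) - ℓ k)) *
        Real.exp (ε * ℓ (k + 1)) * Real.exp (-(ε * ℓ k)))) := by rw [pertSize]; ring
    _ ≤ _ := by gcongr; exact hstep.trans hLk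

/-- The Green operator of the dichotomy, from a forcing at time `k` (acting at time `k + 1`)
to time `m`. -/
def greenOp (A : ℕ → X ≃L[ℝ] X) (P : ℕ → X →L[ℝ] X) (m k : ℕ) : X →L[ℝ] X :=
  if k < m then (transition A m (k + 1)).comp (P (k + 1))
  else -(transition A m (k + 1)).comp (1 - P (k + 1))

theorem greenOp_succ (P : ℕ → X →L[ℝ] X) (m k : ℕ) :
    greenOp A P (m + 1) k =
      (A m : X →L[ℝ] X).comp (greenOp A P m k) + if k = m then 1 else 0 := by
  rcases lt_trichotomy k m with h | rfl | h
  · ext x; simp [greenOp, h, h.ne, h.trans m.lt_succ_self, transition_succ]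
  · ext x; simp [greenOp, transition_self_succ]
  · ext x
    simp [greenOp, h.ne', h.le.not_gt, show ¬ k < m + 1 by omega, transition_succ]

theorem greenBound_greenOp {P : ℕ → X →L[ℝ] X} {b : ℝ} (hN : 0 ≤ N) (hb : 0 < b) (hε : 0 ≤ ε)
    (hℓ : Monotone ℓ) (hL : ∀ k, ℓ (k + 1) - ℓ k ≤ L)
    (hst : ∀ m k, k ≤ m → ‖(transition A m k).comp (P k)‖ ≤
      N * Real.exp (-(2 * b) * (ℓ m - ℓ k)) * Real.exp (ε * ℓ k))
    (hun : ∀ m k, m ≤ k → ‖(transition A m k).comp (1 - P k)‖ ≤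
      N * Real.exp (-(2 * b) * (ℓ k - ℓ m)) * Real.exp (ε * ℓ k)) :
    GreenBound (greenOp A P) (pertSize ℓ ε) ℓ b
      (2 * (N * Real.exp ((ε + 2 * b) * L) / b)) := by
  intro m
  set K := N * Real.exp ((ε + 2 * b) * L) / b with hK
  have hK0 : 0 ≤ K := by positivity
  let F : ℕ → ℝ := fun k =>
    if k ≤ m then Real.exp (b * (ℓ k - ℓ m)) else 2 - Real.exp (-(b * (ℓ k - ℓ m)))
  have hF0 : ∀ k, 0 ≤ F k := fun k => by
    by_cases hk : k ≤ m
    · simp only [F, hk, if_true]; positivity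
    · simp only [F, hk, if_false]
      have : Real.exp (-(b * (ℓ k - ℓ m))) ≤ 1 := Real.exp_le_one_iff.2
        (neg_nonpos.2 (mul_nonneg hb.le (sub_nonneg.2 (hℓ (not_le.1 hk).le))))
      linarith
  have hF2 : ∀ k, F k ≤ 2 := fun k => by
    by_cases hk : k ≤ m
    · simp only [F, hk, if_true]
      have : Real.exp (b * (ℓ k - ℓ m)) ≤ 1 := Real.exp_le_one_iff.2
        (mul_nonpos_of_nonneg_of_nonpos hb.le (sub_nonpos.2 (hℓ hk)))
      linarith
    · simp only [F, hk, if_false]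
      linarith [Real.exp_pos (-(b * (ℓ k - ℓ m)))]
  have hterm : ∀ k, ‖greenOp A P m k‖ * pertSize ℓ ε k * expWeight ℓ b k m ≤
      K * (F (k + 1) - F k) := fun k => by
    have h0 := pertSize_nonneg (ε := ε) hℓ k
    have h1 := (expWeight_pos ℓ b k m).le
    have e3 : 0 ≤ ℓ (k + 1) - ℓ k := sub_nonneg.2 (hℓ k.le_succ)
    have e4 := hL k
    have hb3 := mul_le_mul_of_nonneg_left e4 hb.le
    have hb4 := mul_le_mul_of_nonneg_left e4 hε
    have hb5 := mul_nonneg hb.le e3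
    by_cases hk : k < m
    · have hk1 : k + 1 ≤ m := hk
      have hF : F (k + 1) - F k = Real.exp (b * (ℓ (k + 1) - ℓ m)) - Real.exp (b * (ℓ k - ℓ m)) := by
        simp only [F, hk1, hk.le, if_true]
      have hstep := sub_mul_exp_le (b * (ℓ k - ℓ m)) (b * (ℓ (k + 1) - ℓ m))
      rw [hF, greenOp, if_pos hk]
      refine le_trans ?_ (mul_le_mul_of_nonneg_left hstep hK0)
      calc _ ≤ (N * Real.exp (-(2 * b) * (ℓ m - ℓ (k + 1))) * Real.exp (ε * ℓ (k + 1))) *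
            pertSize ℓ ε k * expWeight ℓ b k m := by gcongr; exact hst m (k + 1) hk1
        _ = N * (ℓ (k + 1) - ℓ k) * Real.exp (-(2 * b) * (ℓ m - ℓ (k + 1)) + ε * ℓ (k + 1) +
            -(ε * ℓ k) + b * (ℓ m - ℓ k)) := by
            rw [pertSize, expWeight, abs_sub_comm, abs_of_nonneg (sub_nonneg.2 (hℓ hk.le))]
            simp only [Real.exp_add]
            ring
        _ ≤ N * (ℓ (k + 1) - ℓ k) * Real.exp ((ε + 2 * b) * L + b * (ℓ k - ℓ m)) := by
            exact mul_le_mul_of_nonneg_left (Real.exp_le_exp.2 (by linarith)) (mul_nonneg hN e3)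
        _ = _ := by rw [hK, Real.exp_add]; field_simp; ring
    · have hmk : m ≤ k := not_lt.1 hk
      have hF : F (k + 1) - F k =
          Real.exp (-(b * (ℓ k - ℓ m))) - Real.exp (-(b * (ℓ (k + 1) - ℓ m))) := by
        have hk2 : ¬ k + 1 ≤ m := by omega
        rcases hmk.eq_or_lt with rfl | hlt
        · simp only [F, hk2, le_refl, if_true, if_false, sub_self, mul_zero, neg_zero]
          rw [Real.exp_zero]; ring
        · simp only [F, hk2, not_le.2 hlt, if_false]; ring
      have hstep := sub_mul_exp_le (-(b * (ℓ (k + 1) - ℓ m))) (-(b * (ℓ k - ℓ m)))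
      rw [hF, greenOp, if_neg hk, norm_neg]
      refine le_trans ?_ (mul_le_mul_of_nonneg_left hstep hK0)
      calc _ ≤ (N * Real.exp (-(2 * b) * (ℓ (k + 1) - ℓ m)) * Real.exp (ε * ℓ (k + 1))) *
            pertSize ℓ ε k * expWeight ℓ b k m := by
            gcongr; exact hun m (k + 1) (hmk.trans k.le_succ)
        _ = N * (ℓ (k + 1) - ℓ k) * Real.exp (-(2 * b) * (ℓ (k + 1) - ℓ m) + ε * ℓ (k + 1) +
            -(ε * ℓ k) + b * (ℓ k - ℓ m)) := by
            rw [pertSize, expWeight, abs_of_nonneg (sub_nonneg.2 (hℓ hmk))]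
            simp only [Real.exp_add]
            ring
        _ ≤ N * (ℓ (k + 1) - ℓ k) *
            Real.exp ((ε + 2 * b) * L + -(b * (ℓ (k + 1) - ℓ m))) := by
            exact mul_le_mul_of_nonneg_left (Real.exp_le_exp.2 (by linarith)) (mul_nonneg hN e3)
        _ = _ := by rw [hK, Real.exp_add]; field_simp; ring
  have hnonneg : ∀ k, 0 ≤ ‖greenOp A P m k‖ * pertSize ℓ ε k * expWeight ℓ b k m := fun k =>
    mul_nonneg (mul_nonneg (norm_nonneg _) (pertSize_nonneg hℓ k)) (expWeight_pos ℓ b k m).le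
  have hpartial : ∀ n, ∑ k ∈ Finset.range n,
      ‖greenOp A P m k‖ * pertSize ℓ ε k * expWeight ℓ b k m ≤ 2 * K := fun n => by
    calc _ ≤ ∑ k ∈ Finset.range n, K * (F (k + 1) - F k) :=
          Finset.sum_le_sum fun k _ => hterm k
      _ = K * (F n - F 0) := by rw [← Finset.mul_sum, Finset.sum_range_sub]
      _ ≤ K * 2 := by gcongr; linarith [hF0 0, hF2 n]
      _ = _ := mul_comm _ _
  exact ⟨summable_of_sum_range_le hnonneg hpartial,
    Real.tsum_le_of_sum_range_le hnonneg hpartial⟩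

end LinearEvolution

section Linearization

theorem exists_pos_mul_le_half {a b c : ℝ} (ha : 0 ≤ a) (hb : 0 ≤ b) (hc : 0 ≤ c) :
    ∃ t : ℝ, 0 < t ∧ ∀ u, 0 ≤ u → u ≤ t → a * u ≤ 1 / 2 ∧ b * u ≤ 1 / 2 ∧ c * u ≤ 1 / 2 := by
  have hpos : 0 < 2 * (1 + a + b + c) := by positivity
  refine ⟨1 / (2 * (1 + a + b + c)), by positivity, fun u hu hut => ?_⟩
  rw [le_div_iff₀ hpos] at hut
  have := mul_nonneg ha hu
  have := mul_nonneg hb hu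
  have := mul_nonneg hc hu
  refine ⟨?_, ?_, ?_⟩ <;> linarith

variable {A : ℕ → X ≃L[ℝ] X} {P : ℕ → X →L[ℝ] X} {ℓ : ℕ → ℝ} {M N s b ε L : ℝ}

theorem TransitionBound.exists_linearization [CompleteSpace X] (hA : TransitionBound A ℓ N s ε)
    (hN : 0 < N) (hℓ : Monotone ℓ) (hL : ∀ k, ℓ (k + 1) - ℓ k ≤ L) (hb : 0 < b) (hs : 0 ≤ s)
    (hbs : b ≤ s + 1) (hε : 0 ≤ ε)
    (hst : ∀ m k, k ≤ m → ‖(transition A m k).comp (P k)‖ ≤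
      N * Real.exp (-(2 * b) * (ℓ m - ℓ k)) * Real.exp (ε * ℓ k))
    (hun : ∀ m k, m ≤ k → ‖(transition A m k).comp (1 - P k)‖ ≤
      N * Real.exp (-(2 * b) * (ℓ k - ℓ m)) * Real.exp (ε * ℓ k)) (hM : 0 < M) :
    ∃ c₀ : ℝ, 0 < c₀ ∧ ∀ (f : ℕ → X → X) (c : ℝ), 0 ≤ c → c ≤ c₀ →
      IsBddLip (pertSize ℓ ε) M c f → ∃ h : ℕ → X ≃ₜ X,
        (∀ n x, h (n + 1) (A n x + f n x) = A n (h n x)) ∧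
        (∃ D : ℝ, 0 < D ∧ ∀ n x, ‖h n x - x‖ ≤ D ∧ ‖(h n).symm x - x‖ ≤ D) ∧
        ∃ K ρ : ℝ, 0 < K ∧ 0 < ρ ∧ ρ ≤ 1 ∧ ∀ n x y,
          ‖(h n x - x) - (h n y - y)‖ ≤ K * (Real.exp (ε * ℓ n) * ‖x - y‖) ^ ρ ∧
          ‖((h n).symm x - x) - ((h n).symm y - y)‖ ≤
            K * (Real.exp (ε * ℓ n) * ‖x - y‖) ^ ρ := by
  have hL0 : 0 ≤ L := (sub_nonneg.2 (hℓ (Nat.le_succ 0))).trans (hL 0)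
  set C := 2 * (N * Real.exp ((ε + 2 * b) * L) / b) with hC
  have hC0 : 0 < C := by positivity
  have hs1 : 0 < s + 1 := by linarith
  obtain ⟨c₀, hc₀, hsmall⟩ := exists_pos_mul_le_half hC0.le
    (by positivity : 0 ≤ N * Real.exp ((s + ε + 1) * L))
    (by positivity : 0 ≤ N * (L * Real.exp ((s + ε) * L)))
  refine ⟨c₀, hc₀, fun f c hc hcc hf => ?_⟩
  obtain ⟨hcC, hcg, hcb⟩ := hsmall c hc hcc
  have hcg' : N * c * Real.exp ((s + ε + 1) * L) ≤ 1 / 2 := by linarith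
  have hcb' : N * c * (L * Real.exp ((s + ε) * L)) ≤ 1 / 2 := by linarith
  have hω := pertSize_nonneg (ε := ε) hℓ
  have h0 : IsBddLip (pertSize ℓ ε) M c fun _ _ => (0 : X) := isBddLip_zero hω hM.le hc
  obtain ⟨h, hconj, hdist, hhol⟩ := exists_conjugating_homeomorph (greenOp_succ P)
    (greenBound_greenOp hN.le hb hε hℓ hL hst hun) hω hb.le hM.le hc hcC hf h0
    (div_pos hb hs1) ((div_le_one hs1).2 hbs) (div_mul_cancel₀ b hs1.ne')
    (fun n => by positivity)
    (hA.bijective_add hN.le hℓ hL hs hε hc hcb' hf)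
    (hA.bijective_add hN.le hℓ hL hs hε hc hcb' h0)
    (hA.orbitGrowth hN.le hℓ hL hs hε hc hcg' hf)
    (hA.orbitGrowth hN.le hℓ hL hs hε hc hcg' h0)
  refine ⟨h, fun n x => by rw [hconj, add_zero], ⟨C * (2 * M), by positivity, hdist⟩,
    4 * C * (2 * M + c) * (2 * N) ^ (b / (s + 1)), b / (s + 1), by positivity,
    div_pos hb hs1, (div_le_one hs1).2 hbs, fun n x y => ?_⟩
  convert hhol n x y using 2 <;>
  · rw [mul_assoc (2 * N), Real.mul_rpow (x := 2 * N) (by positivity) (by positivity)]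
    ring

theorem IsGrowthRate.one_le {μ : ℕ → ℝ} (hμ : IsGrowthRate μ) (n : ℕ) : 1 ≤ μ n :=
  hμ.2.1 ▸ hμ.1.monotone n.zero_le

theorem rpow_eq_exp_log {a : ℝ} (ha : 0 < a) (t : ℝ) : a ^ t = Real.exp (t * Real.log a) := by
  rw [Real.rpow_def_of_pos ha, mul_comm]

theorem div_rpow_eq_exp {a b : ℝ} (ha : 0 < a) (hb : 0 < b) (t : ℝ) :
    (a / b) ^ t = Real.exp (t * (Real.log a - Real.log b)) := by
  rw [rpow_eq_exp_log (div_pos ha hb), Real.log_div ha.ne' hb.ne']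

/-- The increment of a growth rate is controlled by the increment of its logarithm. -/
theorem sub_mul_rpow_le {a b θ ε : ℝ} (ha : 0 < a) (hab : a ≤ b) (hθ : b / a ≤ θ) :
    (b - a) * a ^ (-(1 + ε)) ≤
      θ * ((Real.log b - Real.log a) * Real.exp (-(ε * Real.log a))) := by
  have hb : 0 < b := ha.trans_le hab
  have hlog : 0 ≤ Real.log b - Real.log a := sub_nonneg.2 (Real.log_le_log ha hab)
  have h1 : b / a - 1 ≤ b / a * (Real.log b - Real.log a) := by
    have := mul_le_mul_of_nonneg_left (Real.one_sub_inv_le_log_of_pos (div_pos hb ha))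
      (div_pos hb ha).le
    rwa [mul_sub, mul_one, mul_inv_cancel₀ (div_pos hb ha).ne',
      Real.log_div hb.ne' ha.ne'] at this
  have h2 : b / a - 1 ≤ θ * (Real.log b - Real.log a) :=
    h1.trans (mul_le_mul_of_nonneg_right hθ hlog)
  have h3 : (b - a) * a ^ (-(1 + ε)) = (b / a - 1) * Real.exp (-(ε * Real.log a)) := by
    rw [show -(1 + ε) = -1 + -ε by ring, Real.rpow_add ha, Real.rpow_neg_one,
      rpow_eq_exp_log ha, neg_mul]
    field_simp
  rw [h3, ← mul_assoc]
  exact mul_le_mul_of_nonneg_right h2 (Real.exp_pos _).le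

theorem norm_sub_le_of_norm_sub_sub_le {Y : Type*} [NormedAddCommGroup Y]
    {H : Y → Y} {x y : Y} {K R ρ : ℝ}
    (hρ : 0 < ρ) (hρ1 : ρ ≤ 1) (hR : 1 ≤ R) (hxy : ‖x - y‖ ≤ 1)
    (h : ‖(H x - x) - (H y - y)‖ ≤ K * (R * ‖x - y‖) ^ ρ) :
    ‖H x - H y‖ ≤ (1 + K) * R ^ ρ * ‖x - y‖ ^ ρ := by
  have h1 : ‖x - y‖ ≤ ‖x - y‖ ^ ρ := by
    simpa using Real.rpow_le_rpow_of_exponent_ge_of_imp (norm_nonneg (x - y)) hxy hρ1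
      (fun _ h => absurd h one_ne_zero)
  have h2 : ‖x - y‖ ^ ρ ≤ R ^ ρ * ‖x - y‖ ^ ρ :=
    le_mul_of_one_le_left (by positivity) (Real.one_le_rpow hR hρ.le)
  rw [Real.mul_rpow (by linarith) (norm_nonneg _)] at h
  calc ‖H x - H y‖ = ‖((H x - x) - (H y - y)) + (x - y)‖ := by congr 1; abel
    _ ≤ K * (R ^ ρ * ‖x - y‖ ^ ρ) + R ^ ρ * ‖x - y‖ ^ ρ :=
      (norm_add_le _ _).trans (add_le_add h (h1.trans h2))
    _ = _ := by ring

end Linearization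

/-- Corollary 5.3 (`cor-NTL`), linearization under a strong
nonuniform μ-dichotomy. -/
theorem topological_linearization_nonuniform [CompleteSpace X]
    (μ : ℕ → ℝ) (hμ : IsGrowthRate μ) (θ : ℝ) (hθ : 1 ≤ θ)
    (hμr : ∀ n, μ (n + 1) / μ n ≤ θ)
    (A : ℕ → X ≃L[ℝ] X) (P : ℕ → X →L[ℝ] X)
    (N ν ν' ε : ℝ) (hN : 1 ≤ N) (hν : 0 < ν) (hνν : ν ≤ ν') (hε : 0 ≤ ε)
    (hPP : ∀ k, 1 ≤ k → (P k).comp (P k) = P k)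
    (hAP : ∀ k, 1 ≤ k →
      ((A k : X →L[ℝ] X)).comp (P k) = (P (k + 1)).comp ((A k : X →L[ℝ] X)))
    (h1 : ∀ k m : ℕ, 1 ≤ k → k ≤ m →
      ‖(evolE A m k).comp (P k)‖ ≤ N * (μ m / μ k) ^ (-ν) * μ k ^ ε)
    (h2 : ∀ k m : ℕ, 1 ≤ k → k ≤ m →
      ‖(evolE A m k).comp (1 - P k)‖ ≤ N * (μ m / μ k) ^ ν' * μ k ^ ε)
    (h3 : ∀ m k : ℕ, 1 ≤ m → m ≤ k →
      ‖(evolE A m k).comp (1 - P k)‖ ≤ N * (μ k / μ m) ^ (-ν) * μ k ^ ε)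
    (h4 : ∀ m k : ℕ, 1 ≤ m → m ≤ k →
      ‖(evolE A m k).comp (P k)‖ ≤ N * (μ k / μ m) ^ ν' * μ k ^ ε)
    (M : ℝ) (hM : 0 < M) :
    ∃ c₀ : ℝ, 0 < c₀ ∧ ∀ (g : ℕ → X → X) (c : ℝ), 0 < c → c ≤ c₀ →
      (∀ n, 1 ≤ n → ∀ x : X, ‖g n x‖ ≤ M * (μ (n + 1) - μ n) * μ n ^ (-(1 + ε))) →
      (∀ n, 1 ≤ n → ∀ x y : X,
        ‖g n x - g n y‖ ≤ c * (μ (n + 1) - μ n) * μ n ^ (-(1 + ε)) * ‖x - y‖) →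
      ∃ h : ℕ → X ≃ₜ X,
        (∀ n, 1 ≤ n → ∀ x : X, h (n + 1) (A n x + g n x) = A n (h n x)) ∧
        (∃ D : ℝ, 0 < D ∧ ∀ n, 1 ≤ n → ∀ x : X,
          ‖h n x - x‖ ≤ D ∧ ‖(h n).symm x - x‖ ≤ D) ∧
        ∃ Kb ρ δ : ℝ, 0 < Kb ∧ 0 < ρ ∧ 0 < δ ∧ ∀ n, 1 ≤ n → ∀ x y : X,
          ‖x - y‖ ≤ δ * μ n ^ (-ε) →
            ‖h n x - h n y‖ ≤ Kb * μ n ^ (ρ * ε) * ‖x - y‖ ^ ρ ∧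
            ‖(h n).symm x - (h n).symm y‖ ≤ Kb * μ n ^ (ρ * ε) * ‖x - y‖ ^ ρ := by
  have hpos : ∀ n, 0 < μ n := fun n => one_pos.trans_le (hμ.one_le n)
  set ℓ : ℕ → ℝ := fun n => Real.log (μ (n + 1)) with hℓdef
  have hℓ : Monotone ℓ := fun m k hmk =>
    Real.log_le_log (hpos _) (hμ.1.monotone (Nat.succ_le_succ hmk))
  have hL : ∀ k, ℓ (k + 1) - ℓ k ≤ Real.log θ := fun k => by
    rw [hℓdef, ← Real.log_div (hpos _).ne' (hpos _).ne']
    exact Real.log_le_log (div_pos (hpos _) (hpos _)) (hμr _)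
  have hμε : ∀ k, μ (k + 1) ^ ε = Real.exp (ε * ℓ k) := fun k => rpow_eq_exp_log (hpos _) ε
  have hdiv : ∀ m k t, (μ (m + 1) / μ (k + 1)) ^ t = Real.exp (t * (ℓ m - ℓ k)) := fun m k t =>
    div_rpow_eq_exp (hpos _) (hpos _) t
  set A' : ℕ → X ≃L[ℝ] X := fun n => A (n + 1)
  have hstP : ∀ m k, k ≤ m → ‖(transition A' m k).comp (P (k + 1))‖ ≤
      N * Real.exp (-ν * (ℓ m - ℓ k)) * Real.exp (ε * ℓ k) := fun m k hkm => by
    have := h1 (k + 1) (m + 1) k.succ_pos (Nat.succ_le_succ hkm)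
    rwa [evolE_succ_succ, hμε, hdiv] at this
  have hstQ : ∀ m k, k ≤ m → ‖(transition A' m k).comp (1 - P (k + 1))‖ ≤
      N * Real.exp (ν' * (ℓ m - ℓ k)) * Real.exp (ε * ℓ k) := fun m k hkm => by
    have := h2 (k + 1) (m + 1) k.succ_pos (Nat.succ_le_succ hkm)
    rwa [evolE_succ_succ, hμε, hdiv] at this
  have hunQ : ∀ m k, m ≤ k → ‖(transition A' m k).comp (1 - P (k + 1))‖ ≤
      N * Real.exp (-ν * (ℓ k - ℓ m)) * Real.exp (ε * ℓ k) := fun m k hmk => by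
    have := h3 (m + 1) (k + 1) m.succ_pos (Nat.succ_le_succ hmk)
    rwa [evolE_succ_succ, hμε, hdiv] at this
  have hunP : ∀ m k, m ≤ k → ‖(transition A' m k).comp (P (k + 1))‖ ≤
      N * Real.exp (ν' * (ℓ k - ℓ m)) * Real.exp (ε * ℓ k) := fun m k hmk => by
    have := h4 (m + 1) (k + 1) m.succ_pos (Nat.succ_le_succ hmk)
    rwa [evolE_succ_succ, hμε, hdiv] at this
  have hN0 : 0 < N := one_pos.trans_le hN
  have hν'0 : 0 < ν' := hν.trans_le hνν
  have hweaken : ∀ r w : ℝ, 0 ≤ r → N * Real.exp (-ν * r) * Real.exp w ≤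
      N * Real.exp (ν' * r) * Real.exp w := fun r w hr => by
    have : -ν * r ≤ ν' * r := mul_le_mul_of_nonneg_right (by linarith) hr
    gcongr
  have hdouble : ∀ r w : ℝ, N * Real.exp r * Real.exp w ≤
      2 * N * Real.exp r * Real.exp w := fun r w => by
    gcongr
    linarith
  have hA' : TransitionBound A' ℓ (2 * N) ν' ε := fun m k => by
    have hsplit : transition A' m k = (transition A' m k).comp (P (k + 1)) +
        (transition A' m k).comp (1 - P (k + 1)) := by
      ext x
      simp
    rw [hsplit]
    refine (norm_add_le _ _).trans ?_
    rcases le_total k m with hkm | hmk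
    · have h0 : 0 ≤ ℓ m - ℓ k := sub_nonneg.2 (hℓ hkm)
      rw [abs_of_nonneg h0]
      linarith [hstP m k hkm, hstQ m k hkm, hweaken _ (ε * ℓ k) h0]
    · have h0 : 0 ≤ ℓ k - ℓ m := sub_nonneg.2 (hℓ hmk)
      rw [abs_sub_comm, abs_of_nonneg h0]
      linarith [hunP m k hmk, hunQ m k hmk, hweaken _ (ε * ℓ k) h0]
  have hθ0 : 0 < θ := one_pos.trans_le hθ
  obtain ⟨c₀, hc₀, hlin⟩ := hA'.exists_linearization (P := fun k => P (k + 1)) (b := ν / 2)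
    (M := M * θ) (by positivity) hℓ hL (by positivity) hν'0.le (by linarith) hε
    (fun m k hkm => by
      rw [mul_div_cancel₀ ν two_ne_zero]
      exact (hstP m k hkm).trans (hdouble _ _))
    (fun m k hmk => by
      rw [mul_div_cancel₀ ν two_ne_zero]
      exact (hunQ m k hmk).trans (hdouble _ _)) (by positivity)
  refine ⟨c₀ / θ, by positivity, fun g c hc hcc hgb hgl => ?_⟩
  have hsize : ∀ k, (μ (k + 1 + 1) - μ (k + 1)) * μ (k + 1) ^ (-(1 + ε)) ≤
      θ * pertSize ℓ ε k := fun k =>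
    sub_mul_rpow_le (hpos _) (hμ.1.monotone (Nat.le_succ _)) (hμr _)
  have hf : IsBddLip (pertSize ℓ ε) (M * θ) (c * θ) fun n => g (n + 1) := fun k => by
    refine ⟨fun x => (hgb (k + 1) k.succ_pos x).trans ?_,
      fun x y => (hgl (k + 1) k.succ_pos x y).trans ?_⟩
    · rw [mul_assoc, mul_assoc M]
      exact mul_le_mul_of_nonneg_left (hsize k) hM.le
    · rw [mul_assoc c, mul_assoc c θ]
      exact mul_le_mul_of_nonneg_right (mul_le_mul_of_nonneg_left (hsize k) hc.le) (norm_nonneg _)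
  obtain ⟨h, hconj, ⟨D, hD, hdist⟩, K, ρ, hK, hρ, hρ1, hhol⟩ :=
    hlin _ (c * θ) (by positivity) ((le_div_iff₀ hθ0).1 hcc) hf
  refine ⟨fun n => h (n - 1), ?_, ⟨D, hD, fun n _ => hdist (n - 1)⟩,
    1 + K, ρ, 1, by positivity, hρ, one_pos, ?_⟩
  · rintro (_ | n) hn x
    · exact absurd hn (by norm_num)
    · exact hconj n x
  · rintro (_ | n) hn x y hxy
    · exact absurd hn (by norm_num)
    · have hxy1 : ‖x - y‖ ≤ 1 := hxy.trans <| by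
        rw [one_mul]
        exact Real.rpow_le_one_of_one_le_of_nonpos (hμ.one_le _) (neg_nonpos.2 hε)
      have hR : 1 ≤ Real.exp (ε * ℓ n) := by
        rw [← hμε]
        exact Real.one_le_rpow (hμ.one_le _) hε
      rw [mul_comm ρ ε, Real.rpow_mul (hpos _).le, hμε]
      exact ⟨norm_sub_le_of_norm_sub_sub_le hρ hρ1 hR hxy1 (hhol n x y).1,
        norm_sub_le_of_norm_sub_sub_le hρ hρ1 hR hxy1 (hhol n x y).2⟩

end
end
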